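/- arXiv:2302.02441 — 10 statements merged into one kernel-verified Lean document; each statement's English description precedes it below -/
import Mathlib

section
/- Let K be a field of characteristic zero, A = K[x_1,...,x_n], and let D = Σ_{i=1}^n f_i ∂_i be a K-derivation of A such that f_1,...,f_k ∈ K[x_1,...,x_k] and f_{k+1},...,f_n ∈ K[x_{k+1},...,x_n]. If T = Σ_{i=1}^n g_i ∂_i is a K-derivation of A commuting with D, then the derivations T_1 = Σ_{i=1}^k g_i ∂_i and T_2 = Σ_{i=k+1}^n g_i ∂_i both commute with D, and T = T_1 + T_2. -/
open MvPolynomial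

/-- Two derivations of a polynomial ring commute as soon as they commute on the variables. -/
theorem MvPolynomial.derivation_comm_of_X {R σ : Type*} [CommRing R]
    (S D : Derivation R (MvPolynomial σ R) (MvPolynomial σ R))
    (h : ∀ i, S (D (X i)) = D (S (X i))) (a : MvPolynomial σ R) : S (D a) = D (S a) := by
  have hSD : ⁅S, D⁆ = 0 := derivation_ext fun i => by
    rw [Derivation.commutator_apply, h, sub_self, Derivation.zero_apply]
  rw [← sub_eq_zero, ← Derivation.commutator_apply, hSD, Derivation.zero_apply]

/-- If `D` and `T` commute, and `D` maps the variables in `s` to polynomials in those variables and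
likewise for the variables in `t`, where `s` and `t` cover all the variables, then `D` commutes with
every derivation that agrees with `T` on the variables in `s` and vanishes on those in `t`. -/
theorem MvPolynomial.derivation_comm_of_eqOn_of_eqOn_zero {R σ : Type*} [CommRing R] {s t : Set σ}
    (hst : ∀ i, i ∈ s ∨ i ∈ t) {D T S : Derivation R (MvPolynomial σ R) (MvPolynomial σ R)}
    (hs : ∀ i ∈ s, D (X i) ∈ supported R s) (ht : ∀ i ∈ t, D (X i) ∈ supported R t)
    (hT : ∀ a, T (D a) = D (T a)) (hSs : ∀ i ∈ s, S (X i) = T (X i))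
    (hSt : ∀ i ∈ t, S (X i) = 0) (a : MvPolynomial σ R) : S (D a) = D (S a) := by
  refine derivation_comm_of_X S D (fun i => ?_) a
  rcases hst i with hi | hi
  · rw [derivation_eqOn_supported (D₁ := S) (D₂ := T) hSs (hs i hi), hT, hSs i hi]
  · rw [derivation_eqOn_supported (D₁ := S) (D₂ := 0) hSt (ht i hi), hSt i hi, map_zero,
      Derivation.zero_apply]

/-- If `D = Σ f_i ∂_i` is a derivation of `K[x_1,…,x_n]` with
`f_1,…,f_k ∈ K[x_1,…,x_k]` and `f_{k+1},…,f_n ∈ K[x_{k+1},…,x_n]`, and `T = Σ g_i ∂_i`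
commutes with `D`, then `T_1 = Σ_{i≤k} g_i ∂_i` and `T_2 = Σ_{i>k} g_i ∂_i` both commute
with `D`, and `T = T_1 + T_2`. -/
theorem centralizer_splits_along_decomposition
    (K : Type*) [Field K] [CharZero K] (n k : ℕ)
    (D T : Derivation K (MvPolynomial (Fin n) K) (MvPolynomial (Fin n) K))
    (hD1 : ∀ i : Fin n, (i : ℕ) < k →
        D (X i) ∈ MvPolynomial.supported K {j : Fin n | (j : ℕ) < k})
    (hD2 : ∀ i : Fin n, k ≤ (i : ℕ) →
        D (X i) ∈ MvPolynomial.supported K {j : Fin n | k ≤ (j : ℕ)})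
    (hT : ∀ a : MvPolynomial (Fin n) K, T (D a) = D (T a)) :
    ∀ (T₁ T₂ : Derivation K (MvPolynomial (Fin n) K) (MvPolynomial (Fin n) K)),
      T₁ = MvPolynomial.mkDerivation K (fun i : Fin n => if (i : ℕ) < k then T (X i) else 0) →
      T₂ = MvPolynomial.mkDerivation K (fun i : Fin n => if (i : ℕ) < k then 0 else T (X i)) →
      (∀ a, T₁ (D a) = D (T₁ a)) ∧ (∀ a, T₂ (D a) = D (T₂ a)) ∧ T = T₁ + T₂ := by
  rintro T₁ T₂ rfl rfl
  refine ⟨derivation_comm_of_eqOn_of_eqOn_zero (s := {j : Fin n | (j : ℕ) < k})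
      (t := {j : Fin n | k ≤ (j : ℕ)}) (fun i => lt_or_ge (i : ℕ) k) hD1 hD2 hT ?_ ?_,
    derivation_comm_of_eqOn_of_eqOn_zero (s := {j : Fin n | k ≤ (j : ℕ)})
      (t := {j : Fin n | (j : ℕ) < k}) (fun i => le_or_gt k (i : ℕ)) hD2 hD1 hT ?_ ?_,
    derivation_ext fun i => ?_⟩
  · intro i hi
    exact (mkDerivation_X K _ i).trans (if_pos hi)
  · intro i hi
    exact (mkDerivation_X K _ i).trans (if_neg (not_lt.mpr hi))
  · intro i hi
    exact (mkDerivation_X K _ i).trans (if_neg (not_lt.mpr hi))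
  · intro i hi
    exact (mkDerivation_X K _ i).trans (if_pos hi)
  · rw [Derivation.add_apply, mkDerivation_X, mkDerivation_X]
    split_ifs <;> simp
end

section
/- Let K be an algebraically closed field of characteristic zero, A = K[x_1,...,x_n], R = K(x_1,...,x_n) the field of rational functions, and let D = Σ_{i,j=1}^n a_{ij} x_j ∂_i be a nonzero linear K-derivation of A with a_{ij} ∈ K. Let F = Ker_R(D) be the field of constants of the unique extension of D to a derivation of R, and let C_{gl_n}(D) denote the set of linear derivations Σ_{i,j} b_{ij} x_j ∂_i commuting with D. Then a K-derivation T of A commutes with D if and only if, viewed as a derivation of R, T is an F-linear combination of elements of C_{gl_n}(D); that is, C_{W_n(K)}(D) = (F · C_{gl_n}(D)) ∩ W_n(K). -/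
open MvPolynomial

open Polynomial in
/-- A finite-dimensional vector space is cyclic over the centralizer of any endomorphism. -/
theorem Module.End.exists_commute_apply_eq {K V : Type*} [Field K] [AddCommGroup V] [Module K V]
    [FiniteDimensional K V] (f : Module.End K V) :
    ∃ v : V, ∀ w : V, ∃ g : Module.End K V, Commute g f ∧ g v = w := by
  classical
  have : Module.IsTorsion K[X] (Module.AEval' f) :=
    Module.AEval.isTorsion_of_finiteDimensional K V f
  obtain ⟨ι, _, p, -, e, ⟨E⟩⟩ := Module.equiv_directSum_of_isTorsion this
  let o := Module.AEval'.of f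
  let u : DirectSum ι fun i ↦ K[X] ⧸ K[X] ∙ p i ^ e i :=
    DFinsupp.equivFunOnFintype.symm fun _ ↦ Submodule.Quotient.mk 1
  refine ⟨o.symm (E.symm u), fun w ↦ ?_⟩
  choose q hq using fun i ↦ Submodule.Quotient.mk_surjective _ (E (o w) i)
  let m : (DirectSum ι fun i ↦ K[X] ⧸ K[X] ∙ p i ^ e i) →ₗ[K[X]]
      DirectSum ι fun i ↦ K[X] ⧸ K[X] ∙ p i ^ e i :=
    DFinsupp.mapRange.linearMap fun i ↦ LinearMap.lsmul K[X] _ (q i)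
  let G : Module.AEval' f →ₗ[K[X]] Module.AEval' f := E.symm.toLinearMap ∘ₗ m ∘ₗ E.toLinearMap
  have hm : m u = E (o w) := by
    refine DFinsupp.ext fun i ↦ ?_
    rw [← hq i]
    change q i • (Submodule.Quotient.mk 1 : K[X] ⧸ K[X] ∙ p i ^ e i) = _
    rw [← Submodule.Quotient.mk_smul, smul_eq_mul, mul_one]
  refine ⟨o.symm.toLinearMap ∘ₗ G.restrictScalars K ∘ₗ o.toLinearMap, ?_, ?_⟩
  · refine LinearMap.ext fun x ↦ ?_
    change o.symm (G (o (f x))) = f (o.symm (G (o x)))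
    apply o.injective
    rw [LinearEquiv.apply_symm_apply, ← Module.AEval'.X_smul_of f x, map_smul,
      ← Module.AEval'.X_smul_of f, LinearEquiv.apply_symm_apply]
  · change o.symm (E.symm (m (E (o (o.symm (E.symm u)))))) = w
    simp [hm]

theorem Derivation.sum_apply {k A M ι : Type*} [CommSemiring k] [CommSemiring A]
    [AddCommMonoid M] [Algebra k A] [Module A M] [Module k M] (s : Finset ι)
    (D : ι → Derivation k A M) (a : A) : (∑ i ∈ s, D i) a = ∑ i ∈ s, D i a := by
  classical
  induction s using Finset.induction_on with
  | empty => simp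
  | insert i s hi ih => simp [Finset.sum_insert hi, ih]

/-- A derivation of `A` extends to any localization of `A`. -/
theorem Derivation.exists_extension_of_isLocalization {k A B : Type*} [CommRing k] [CommRing A]
    [CommRing B] [Algebra k A] [Algebra k B] [Algebra A B] [IsScalarTower k A B]
    (S : Submonoid A) [IsLocalization S B] (d : Derivation k A B) :
    ∃ d' : Derivation k B B, ∀ a, d' (algebraMap A B a) = d a := by
  have := Algebra.FormallyEtale.of_isLocalization (Rₘ := B) S
  have h := KaehlerDifferential.isBaseChange_of_formallyEtale k A B
  refine ⟨(h.lift d.liftKaehlerDifferential).compDer (KaehlerDifferential.D k B), fun a ↦ ?_⟩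
  have := h.lift_eq d.liftKaehlerDifferential (KaehlerDifferential.D k A a)
  rw [KaehlerDifferential.map_D] at this
  simpa using this

namespace MvPolynomial

variable {K σ R : Type*} [Field K] [Field R] [Algebra K R] [Algebra (MvPolynomial σ K) R]
  [IsScalarTower K (MvPolynomial σ K) R] [IsFractionRing (MvPolynomial σ K) R]

theorem derivation_fractionRing_ext {D₁ D₂ : Derivation K R R}
    (h : ∀ i, D₁ (algebraMap (MvPolynomial σ K) R (X i)) =
      D₂ (algebraMap (MvPolynomial σ K) R (X i))) : D₁ = D₂ := by
  have hp : D₁.compAlgebraMap (MvPolynomial σ K) = D₂.compAlgebraMap (MvPolynomial σ K) :=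
    derivation_ext h
  ext r
  obtain ⟨p, q, -, rfl⟩ := IsFractionRing.div_surjective (A := MvPolynomial σ K) r
  have hp (p : MvPolynomial σ K) : D₁ (algebraMap (MvPolynomial σ K) R p) =
      D₂ (algebraMap (MvPolynomial σ K) R p) := DFunLike.congr_fun hp p
  rw [Derivation.leibniz_div, Derivation.leibniz_div, hp, hp]

theorem exists_derivation_fractionRing (f : σ → R) :
    ∃ D : Derivation K R R, ∀ i, D (algebraMap (MvPolynomial σ K) R (X i)) = f i := by
  obtain ⟨D, hD⟩ :=
    (mkDerivation K f).exists_extension_of_isLocalization (nonZeroDivisors (MvPolynomial σ K))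
  exact ⟨D, fun i ↦ by rw [hD, mkDerivation_X]⟩

theorem derivation_fractionRing_commute {D U : Derivation K R R}
    (h : ∀ i, U (D (algebraMap (MvPolynomial σ K) R (X i))) =
      D (U (algebraMap (MvPolynomial σ K) R (X i)))) (r : R) :
    U (D r) = D (U r) := by
  have : ⁅U, D⁆ = 0 := derivation_fractionRing_ext fun i ↦ by
    rw [Derivation.commutator_apply, h, sub_self, Derivation.zero_apply]
  simpa [Derivation.commutator_apply, sub_eq_zero] using DFunLike.congr_fun this r

end MvPolynomial

open Matrix in
/-- The vectors `B x`, with `B` commuting with `M` and `x` the vector of variables, contain a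
basis of the space of vectors of rational functions. -/
theorem Matrix.exists_commute_det_ne_zero {K ι : Type*} [Field K] [Fintype ι] [DecidableEq ι]
    (M : Matrix ι ι K) :
    ∃ B : ι → Matrix ι ι K, (∀ j, Commute (B j) M) ∧
      (Matrix.of fun i j ↦ ∑ l, B j i l • (X l : MvPolynomial ι K)).det ≠ 0 := by
  obtain ⟨v, hv⟩ := Module.End.exists_commute_apply_eq (toLin' M)
  choose g hg hgv using fun j : ι ↦ hv (Pi.single j 1)
  refine ⟨fun j ↦ LinearMap.toMatrix' (g j), fun j ↦ ?_, fun h ↦ ?_⟩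
  · have := congrArg LinearMap.toMatrix' (hg j).eq
    rwa [LinearMap.toMatrix'_mul, LinearMap.toMatrix'_mul, LinearMap.toMatrix'_toLin'] at this
  · apply_fun MvPolynomial.eval v at h
    rw [RingHom.map_det, map_zero] at h
    refine one_ne_zero (α := K) ?_
    rw [← h, ← Matrix.det_one (n := ι)]
    congr 1
    ext i j
    have := congrFun (LinearMap.toMatrix'_mulVec (g j) v) i
    rw [hgv] at this
    simp only [RingHom.mapMatrix_apply, map_apply, of_apply, map_sum, smul_eval, eval_X]
    rw [Matrix.one_apply, ← Pi.single_apply, ← this]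
    rfl



/-- For a nonzero linear derivation `D` of `A = K[x_1,…,x_n]` (extended to the field of
rational functions `R`), a derivation `T` of `R` mapping `A` into `A` commutes with `D`
iff it is an `F`-linear combination of linear derivations commuting with `D`, where
`F = Ker_R D` is the field of constants: `C_{W_n}(D) = (F·C_{gl_n}(D)) ∩ W_n(K)`. -/
theorem centralizer_of_linear_derivation
    (K : Type*) [Field K] [IsAlgClosed K] [CharZero K] (n : ℕ)
    (a : Fin n → Fin n → K)
    (D : Derivation K (FractionRing (MvPolynomial (Fin n) K))
        (FractionRing (MvPolynomial (Fin n) K)))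
    (hD : ∀ i : Fin n,
        D (algebraMap (MvPolynomial (Fin n) K) (FractionRing (MvPolynomial (Fin n) K)) (X i))
          = ∑ j : Fin n, a i j •
              algebraMap (MvPolynomial (Fin n) K) (FractionRing (MvPolynomial (Fin n) K)) (X j))
    (hD0 : D ≠ 0)
    (T : Derivation K (FractionRing (MvPolynomial (Fin n) K))
        (FractionRing (MvPolynomial (Fin n) K)))
    (hTA : ∀ p : MvPolynomial (Fin n) K,
        T (algebraMap (MvPolynomial (Fin n) K) (FractionRing (MvPolynomial (Fin n) K)) p)
          ∈ (algebraMap (MvPolynomial (Fin n) K) (FractionRing (MvPolynomial (Fin n) K))).range) :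
    (∀ r, T (D r) = D (T r)) ↔
      ∃ (m : ℕ) (φ : Fin m → FractionRing (MvPolynomial (Fin n) K))
        (U : Fin m → Derivation K (FractionRing (MvPolynomial (Fin n) K))
            (FractionRing (MvPolynomial (Fin n) K))),
        (∀ j, D (φ j) = 0) ∧
        (∀ j, (∀ r, (U j) (D r) = D ((U j) r)) ∧
          ∃ b : Fin n → Fin n → K, ∀ i : Fin n,
            (U j) (algebraMap (MvPolynomial (Fin n) K)
                (FractionRing (MvPolynomial (Fin n) K)) (X i))
              = ∑ l : Fin n, b i l •
                  algebraMap (MvPolynomial (Fin n) K)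
                    (FractionRing (MvPolynomial (Fin n) K)) (X l)) ∧
        T = ∑ j, φ j • U j := by
  constructor
  · intro hT
    obtain ⟨B, hB, hdet⟩ := (Matrix.of a).exists_commute_det_ne_zero
    set x : Fin n → FractionRing (MvPolynomial (Fin n) K) :=
      fun i ↦ algebraMap (MvPolynomial (Fin n) K) _ (X i) with hx
    let Q : Matrix (Fin n) (Fin n) (FractionRing (MvPolynomial (Fin n) K)) :=
      Matrix.of fun i j ↦ ∑ l, B j i l • x l
    have hQ : IsUnit Q.det := by
      have : Q = (algebraMap (MvPolynomial (Fin n) K)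
          (FractionRing (MvPolynomial (Fin n) K))).mapMatrix
          (Matrix.of fun i j ↦ ∑ l, B j i l • (X l : MvPolynomial (Fin n) K)) := by
        ext i j
        simp [Q, hx, algebraMap.coe_smul]
      rw [this, ← RingHom.map_det, isUnit_iff_ne_zero]
      simpa using hdet
    have hDQ (i j : Fin n) : D (Q i j) = ∑ k, a i k • Q k j := by
      simp only [Q, Matrix.of_apply, map_sum, Derivation.map_smul, hx, hD, Finset.smul_sum,
        smul_smul]
      rw [Finset.sum_comm, Finset.sum_comm (s := Finset.univ (α := Fin n))
        (f := fun k l ↦ (a i k * B j k l) • algebraMap (MvPolynomial (Fin n) K)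
          (FractionRing (MvPolynomial (Fin n) K)) (X l))]
      refine Finset.sum_congr rfl fun l _ ↦ ?_
      rw [← Finset.sum_smul, ← Finset.sum_smul]
      congr 1
      exact congrFun (congrFun (hB j).eq i) l
    choose U hU using fun j ↦ exists_derivation_fractionRing (K := K) (σ := Fin n) fun i ↦ Q i j
    let φ := Q⁻¹.mulVec fun i ↦ T (x i)
    have hφ : Q.mulVec φ = fun i ↦ T (x i) := by
      rw [Matrix.mulVec_mulVec, Matrix.mul_nonsing_inv _ hQ, Matrix.one_mulVec]
    have hφ' (i : Fin n) : T (x i) = ∑ j, Q i j * φ j := (congrFun hφ i).symm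
    refine ⟨n, φ, U, ?_, fun j ↦ ⟨derivation_fractionRing_commute (σ := Fin n) fun i ↦ ?_,
      fun i l ↦ B j i l, fun i ↦ hU j i⟩, derivation_fractionRing_ext (σ := Fin n) fun i ↦ ?_⟩
    · have h0 : Q.mulVec (fun j ↦ D (φ j)) = 0 := by
        ext i
        have h := hT (x i)
        simp only [hx, hD, map_sum, Derivation.map_smul] at h
        change ∑ k, a i k • T (x k) = D (T (x i)) at h
        simp only [hφ', map_sum, Derivation.leibniz, hDQ, Finset.sum_add_distrib, smul_eq_mul,
          Finset.smul_sum, mul_comm (φ _), Finset.sum_mul, smul_mul_assoc] at h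
        rw [Finset.sum_comm] at h
        exact right_eq_add.mp h
      have := congrArg Q⁻¹.mulVec h0
      rw [Matrix.mulVec_mulVec, Matrix.nonsing_inv_mul _ hQ, Matrix.one_mulVec,
        Matrix.mulVec_zero] at this
      exact congrFun this
    · rw [hU, hDQ, hD, map_sum]
      simp only [Derivation.map_smul, hU]
    · rw [Derivation.sum_apply]
      refine (hφ' i).trans (Finset.sum_congr rfl fun j _ ↦ ?_)
      simp [hU, mul_comm]
  · rintro ⟨m, φ, U, hφ, hU, rfl⟩ r
    have key (s) : (∑ j, φ j • U j) s = ∑ j, φ j * U j s := by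
      simp [Derivation.sum_apply]
    simp [key, (hU _).1 r, hφ]
end

section
/- Let K be a field of characteristic zero, A = K[x_1,...,x_n], and let D be the basic Weitzenböck derivation of A, given by D(x_1) = 0 and D(x_i) = x_{i-1} for 2 ≤ i ≤ n. A K-derivation T of A commutes with D if and only if there exists a polynomial f ∈ A with D^n(f) = 0 such that T = D_f, where D_f = D^{n-1}(f) ∂_1 + D^{n-2}(f) ∂_2 + ... + D(f) ∂_{n-1} + f ∂_n. -/
open MvPolynomial

/-- A derivation `T` of `K[x_1,…,x_n]` commutes with the basic Weitzenböck derivation `D`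
(`D(x_1)=0`, `D(x_i)=x_{i-1}`) iff `T = D_f = Σ_i D^{n-i}(f) ∂_i` for some polynomial `f`
with `D^n(f) = 0`. -/
theorem centralizer_basic_weitzenbock
    (K : Type*) [Field K] [CharZero K] (n : ℕ) (hn : 0 < n)
    (D : Derivation K (MvPolynomial (Fin n) K) (MvPolynomial (Fin n) K))
    (hD : ∀ i : Fin n, D (X i) =
        if h : (i : ℕ) = 0 then 0 else X (⟨(i : ℕ) - 1, by omega⟩ : Fin n))
    (T : Derivation K (MvPolynomial (Fin n) K) (MvPolynomial (Fin n) K)) :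
    (∀ a, T (D a) = D (T a)) ↔
      ∃ f : MvPolynomial (Fin n) K, (⇑D)^[n] f = 0 ∧
        T = MvPolynomial.mkDerivation K
          (fun i : Fin n => (⇑D)^[n - 1 - (i : ℕ)] f) := by
  constructor
  · intro hT
    have iterate_eq : ∀ k : ℕ, ∀ i : Fin n, (i : ℕ) + k = n - 1 →
        T (X i) = (⇑D)^[k] (T (X (⟨n - 1, by omega⟩ : Fin n))) := by
      intro k
      induction k with
      | zero =>
        intro i hi
        have : i = ⟨n - 1, by omega⟩ := Fin.ext (by simpa using hi)
        rw [this, Function.iterate_zero, id]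
      | succ k ih =>
        intro i hi
        have hX : D (X (⟨(i : ℕ) + 1, by omega⟩ : Fin n)) = X i := by
          rw [hD, dif_neg (Nat.succ_ne_zero _)]
          rfl
        rw [Function.iterate_succ_apply', ← ih ⟨(i : ℕ) + 1, by omega⟩ (by simp only; omega),
          ← hT, hX]
    refine ⟨T (X (⟨n - 1, by omega⟩ : Fin n)), ?_, ?_⟩
    · obtain ⟨m, rfl⟩ : ∃ m, n = m + 1 := ⟨n - 1, by omega⟩
      rw [Function.iterate_succ_apply', ← iterate_eq m ⟨0, hn⟩ (by simp), ← hT, hD,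
        dif_pos rfl, map_zero]
    · refine MvPolynomial.derivation_ext fun i => ?_
      rw [mkDerivation_X]
      exact iterate_eq _ i (by omega)
  · rintro ⟨f, hf, rfl⟩ a
    rw [← sub_eq_zero, ← Derivation.commutator_apply]
    suffices h : ⁅mkDerivation K (fun i : Fin n => (⇑D)^[n - 1 - (i : ℕ)] f), D⁆ = 0 by
      rw [h, Derivation.zero_apply]
    refine MvPolynomial.derivation_ext fun i => ?_
    rw [Derivation.commutator_apply, Derivation.zero_apply, sub_eq_zero, mkDerivation_X,
      ← Function.iterate_succ_apply' (⇑D), hD]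
    split_ifs with h
    · rw [map_zero, h, show (n - 1 - 0).succ = n by omega, hf]
    · rw [mkDerivation_X]
      congr 2
      simp only
      omega
end

section
/- Let K be a field of characteristic zero, A = K[x_1,...,x_n], D the basic Weitzenböck derivation (D(x_1)=0, D(x_i)=x_{i-1} for i≥2), and D̂ the derivation with D̂(x_i)=i(n−i)x_{i+1} for i ≤ n−1, D̂(x_n)=0. Set A_k = Ker D^k for k ≥ 0. If b ∈ A_k \ A_{k-1} is an isobaric polynomial with k ≥ 2 (i.e. D^k(b) = 0 but D^{k-1}(b) ≠ 0), then D̂(D(b)) ∈ A_k \ A_{k-1}, that is, D^k(D̂(D(b))) = 0 and D^{k-1}(D̂(D(b))) ≠ 0. -/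
open MvPolynomial

section SlTwo

variable {K V : Type*} [Field K] [AddCommGroup V] [Module K V] {e f h : V →ₗ[K] V}

theorem weight_iterate_raise (he : ∀ v, h (e v) = e (h v) + (2 : K) • e v)
    {v : V} {c : K} (hv : h v = c • v) (m : ℕ) :
    h (e^[m] v) = (c + 2 * m) • e^[m] v := by
  induction m with
  | zero => simp [hv]
  | succ m ih =>
    rw [Function.iterate_succ_apply', he, ih, map_smul, ← add_smul]
    push_cast
    ring_nf

theorem iterate_raise_lower (he : ∀ v, h (e v) = e (h v) + (2 : K) • e v)
    (hf : ∀ v, e (f v) = f (e v) + h v) {v : V} {c : K} (hv : h v = c • v) (m : ℕ) :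
    e^[m + 1] (f v) = f (e^[m + 1] v) + ((m + 1) * (c + m) : K) • e^[m] v := by
  induction m with
  | zero => simp [hf, hv]
  | succ m ih =>
    rw [Function.iterate_succ_apply', ih, map_add, hf, map_smul, weight_iterate_raise he hv,
      ← Function.iterate_succ_apply' e (m + 1), ← Function.iterate_succ_apply' e m, add_assoc,
      ← add_smul]
    congr 2
    push_cast
    ring

theorem eq_zero_of_lower_eq_zero [CharZero K] (he : ∀ v, h (e v) = e (h v) + (2 : K) • e v)
    (hf : ∀ v, e (f v) = f (e v) + h v) {v : V} {k m : ℕ} (hv : h v = (-k : K) • v)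
    (hfv : f v = 0) (hmk : m ≤ k) (hev : e^[m] v = 0) : v = 0 := by
  induction m with
  | zero => simpa using hev
  | succ m ih =>
    refine ih (by omega) ?_
    have key := iterate_raise_lower he hf hv m
    rw [hfv, hev, iterate_map_zero, map_zero, zero_add] at key
    refine (smul_eq_zero.1 key.symm).resolve_left
      (mul_ne_zero (by exact_mod_cast m.succ_ne_zero) ?_)
    rw [neg_add_eq_sub, sub_ne_zero]
    exact_mod_cast (by omega : m ≠ k)

/-- The `k`-th power of the raising operator is injective on `f`-nilpotent vectors of
weight `-k`. -/
theorem eq_zero_of_iterate_raise_eq_zero [CharZero K]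
    (he : ∀ v, h (e v) = e (h v) + (2 : K) • e v)
    (hf : ∀ v, e (f v) = f (e v) + h v) {v : V} {k N : ℕ} (hv : h v = (-k : K) • v)
    (hN : f^[N] v = 0) (hev : e^[k] v = 0) (hhf : ∀ v, h (f v) = f (h v) - (2 : K) • f v) :
    v = 0 := by
  induction N generalizing v k with
  | zero => simpa using hN
  | succ N ih =>
    have hev' : e^[k + 1] v = 0 := by rw [Function.iterate_succ_apply', hev, map_zero]
    have key : e^[k + 2] (f v) = 0 := by
      rw [iterate_raise_lower he hf hv (k + 1), Function.iterate_succ_apply', hev']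
      simp
    refine eq_zero_of_lower_eq_zero he hf hv (ih (k := k + 2) ?_ hN key) le_rfl hev
    rw [hhf, hv, map_smul, ← sub_smul]
    push_cast
    ring_nf

end SlTwo

theorem Derivation.iterate_mul_eq_zero {R A : Type*} [CommSemiring R] [CommSemiring A]
    [Algebra R A] (D : Derivation R A A) {x y : A} {p q : ℕ}
    (hx : D^[p] x = 0) (hy : D^[q] y = 0) : D^[p + q] (x * y) = 0 := by
  induction hs : p + q generalizing x y p q with
  | zero =>
    obtain rfl : p = 0 := by omega
    have hx0 : x = 0 := hx
    simp [hx0]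
  | succ s ih =>
    rcases p with _ | p
    · have hx0 : x = 0 := hx
      rw [hx0, zero_mul, iterate_map_zero]
    rcases q with _ | q
    · have hy0 : y = 0 := hy
      rw [hy0, mul_zero, iterate_map_zero]
    rw [Function.iterate_succ_apply, D.leibniz, iterate_map_add, smul_eq_mul, smul_eq_mul,
      mul_comm y, ih hx (show D^[q] (D y) = 0 from hy) (by omega),
      ih (show D^[p] (D x) = 0 from hx) hy (by omega), add_zero]

theorem Derivation.exists_iterate_eq_zero {R σ : Type*} [CommSemiring R]
    (D : Derivation R (MvPolynomial σ R) (MvPolynomial σ R))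
    (hD : ∀ i, ∃ N, D^[N] (X i) = 0) (p : MvPolynomial σ R) : ∃ N, D^[N] p = 0 := by
  induction p using MvPolynomial.induction_on with
  | C a => exact ⟨1, D.map_algebraMap a⟩
  | add p q hp hq =>
    obtain ⟨M, hM⟩ := hp
    obtain ⟨N, hN⟩ := hq
    refine ⟨M + N, ?_⟩
    rw [iterate_map_add, Function.iterate_add_apply _ M N q, hN, add_comm M,
      Function.iterate_add_apply, hM, iterate_map_zero, iterate_map_zero, add_zero]
  | mul_X p i hp =>
    obtain ⟨M, hM⟩ := hp
    obtain ⟨N, hN⟩ := hD i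
    exact ⟨M + N, D.iterate_mul_eq_zero hM hN⟩

/-- If `b` is an isobaric polynomial with `D^k(b) = 0` but `D^{k-1}(b) ≠ 0` (`k ≥ 2`),
where `D` is the basic Weitzenböck derivation and `D̂` its opposite `sl_2`-partner, then
`D̂(D(b))` also satisfies `D^k(D̂(D(b))) = 0` and `D^{k-1}(D̂(D(b))) ≠ 0`, i.e.
`D̂(D(b)) ∈ A_k \ A_{k-1}`. -/
theorem isobaric_filtration_stability
    (K : Type*) [Field K] [CharZero K] (n : ℕ)
    (D Dhat H : Derivation K (MvPolynomial (Fin n) K) (MvPolynomial (Fin n) K))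
    (hD : ∀ i : Fin n, D (X i) =
        if h : (i : ℕ) = 0 then 0 else X (⟨(i : ℕ) - 1, by omega⟩ : Fin n))
    (hDhat : ∀ i : Fin n, Dhat (X i) =
        if h : (i : ℕ) + 1 < n
        then (((i : ℕ) + 1) * (n - ((i : ℕ) + 1)) : K) • X (⟨(i : ℕ) + 1, h⟩ : Fin n)
        else 0)
    (hH : ∀ i : Fin n, H (X i) = ((n : K) - 2 * ((i : ℕ) + 1) + 1) • X i)
    (b : MvPolynomial (Fin n) K) (lam : K) (hb : H b = lam • b)
    (k : ℕ) (hk : 2 ≤ k)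
    (hbk : (⇑D)^[k] b = 0) (hbk1 : (⇑D)^[k - 1] b ≠ 0) :
    (⇑D)^[k] (Dhat (D b)) = 0 ∧ (⇑D)^[k - 1] (Dhat (D b)) ≠ 0 := by
  have comm : ⁅D, Dhat⁆ = H := by
    refine MvPolynomial.derivation_ext fun i => ?_
    rw [Derivation.commutator_apply, hD, hDhat, hH]
    obtain ⟨i, hi⟩ := i
    rcases i with _ | i
    · by_cases h1 : 1 < n
      · simp [h1, hD]
        ring_nf
      · obtain rfl : n = 1 := by omega
        norm_num
    · by_cases h1 : i + 1 + 1 < n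
      · simp [h1, hi, hD, hDhat, ← sub_smul]
        ring_nf
      · obtain rfl : n = i + 2 := by omega
        simp [hDhat, ← neg_smul]
        ring_nf
  have commD : ⁅H, D⁆ = (2 : K) • D := by
    refine MvPolynomial.derivation_ext fun i => ?_
    rw [Derivation.commutator_apply, Derivation.smul_apply, hD, hH, Derivation.map_smul, hD]
    split_ifs with h0
    · simp
    · obtain ⟨i, hi⟩ := i
      obtain ⟨i, rfl⟩ := Nat.exists_eq_succ_of_ne_zero h0
      simp [hH, ← sub_smul]
      ring_nf
  have commDhat : ⁅H, Dhat⁆ = (-2 : K) • Dhat := by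
    refine MvPolynomial.derivation_ext fun i => ?_
    rw [Derivation.commutator_apply, Derivation.smul_apply, hDhat, hH, Derivation.map_smul, hDhat]
    split_ifs with h0
    · simp only [Derivation.map_smul, hH, smul_smul, ← sub_smul]
      push_cast
      ring_nf
    · simp
  have nilp : ∃ N, Dhat^[N] b = 0 := by
    refine Dhat.exists_iterate_eq_zero (fun i => ⟨n - i, ?_⟩) b
    induction hm : n - (i : ℕ) generalizing i with
    | zero => omega
    | succ m ih =>
      rw [Function.iterate_succ_apply, hDhat]
      split_ifs with h1
      · rw [← Derivation.coeFn_coe, ← Module.End.pow_apply, map_smul, Module.End.pow_apply,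
          Derivation.coeFn_coe, ih ⟨i + 1, h1⟩ (by simp only; omega), smul_zero]
      · exact iterate_map_zero _ _
  obtain ⟨N, hN⟩ := nilp
  let A := MvPolynomial (Fin n) K
  have he : ∀ v, (H : A →ₗ[K] A) ((D : A →ₗ[K] A) v) =
      (D : A →ₗ[K] A) ((H : A →ₗ[K] A) v) + (2 : K) • (D : A →ₗ[K] A) v := fun v =>
    by
    have h := DFunLike.congr_fun commD v
    rw [Derivation.commutator_apply, sub_eq_iff_eq_add'] at h
    exact h
  have hf : ∀ v, (D : A →ₗ[K] A) ((Dhat : A →ₗ[K] A) v) =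
      (Dhat : A →ₗ[K] A) ((D : A →ₗ[K] A) v) + (H : A →ₗ[K] A) v := fun v =>
    by
    have h := DFunLike.congr_fun comm v
    rw [Derivation.commutator_apply, sub_eq_iff_eq_add'] at h
    exact h
  have hhf : ∀ v, (H : A →ₗ[K] A) ((Dhat : A →ₗ[K] A) v) =
      (Dhat : A →ₗ[K] A) ((H : A →ₗ[K] A) v) - (2 : K) • (Dhat : A →ₗ[K] A) v := fun v => by
    have h := DFunLike.congr_fun commDhat v
    rw [Derivation.commutator_apply, sub_eq_iff_eq_add', Derivation.smul_apply, neg_smul,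
      ← sub_eq_add_neg] at h
    exact h
  obtain ⟨m, rfl⟩ : ∃ m, k = m + 2 := ⟨k - 2, by omega⟩
  have hDb : H (D b) = (lam + 2 : K) • D b := by
    simpa using weight_iterate_raise he hb 1
  have formula (j : ℕ) : D^[j + 1] (Dhat (D b)) =
      Dhat (D^[j + 2] b) + ((j + 1) * (lam + 2 + j) : K) • D^[j + 1] b :=
    iterate_raise_lower he hf hDb j
  have hbk' : D^[m + 3] b = 0 := by rw [Function.iterate_succ_apply', hbk, map_zero]
  constructor
  · rw [formula (m + 1), hbk, hbk', map_zero, smul_zero, add_zero]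
  · rw [Nat.add_sub_cancel_right (m + 1) 1] at hbk1 ⊢
    rw [formula m, hbk, map_zero, zero_add]
    refine smul_ne_zero (mul_ne_zero (by exact_mod_cast m.succ_ne_zero) fun h0 => hbk1 ?_) hbk1
    have hlam : lam = -((m + 2 : ℕ) : K) := by
      push_cast
      linear_combination h0
    rw [hlam] at hb
    rw [eq_zero_of_iterate_raise_eq_zero he hf hb hN hbk hhf, iterate_map_zero]
end

section
/- Let K be a field of characteristic zero, A = K[x_1,...,x_n], D the basic Weitzenböck derivation (D(x_1)=0, D(x_i)=x_{i-1} for i≥2), and D̂ the derivation with D̂(x_i)=i(n−i)x_{i+1} for i ≤ n−1, D̂(x_n)=0. If b ∈ A is an isobaric polynomial, then for every s ≥ 2 there exists a scalar λ = λ(s) ∈ K such that D^{s-1}(D̂(D(b))) = D̂(D^s(b)) + λ·D^{s-1}(b). -/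
open MvPolynomial

section WeitzenboeckTriple

variable {K A : Type*} [CommRing K] [CommRing A] [Algebra K A]

/-- If `[H, D] = 2D`, then `D` raises `H`-eigenvalues by `2`. -/
theorem Derivation.apply_iterate_eq_smul_of_lie_eq_two_smul
    {D H : Derivation K A A} (hHD : ⁅H, D⁆ = (2 : K) • D)
    {b : A} {mu : K} (hb : H b = mu • b) (k : ℕ) :
    H ((⇑D)^[k] b) = (mu + 2 * k) • (⇑D)^[k] b := by
  induction k with
  | zero => simpa using hb
  | succ k ih =>
    have h := DFunLike.congr_fun hHD ((⇑D)^[k] b)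
    rw [Derivation.commutator_apply, ih, Derivation.map_smul, Derivation.smul_apply,
      sub_eq_iff_eq_add, ← add_smul] at h
    rw [Function.iterate_succ_apply', h]
    congr 1
    push_cast
    ring

/-- Commuting the lowering operator past powers of the raising operator on an eigenvector. -/
theorem Derivation.exists_iterate_eq_add_smul_of_lie
    {D E H : Derivation K A A} (hDE : ⁅D, E⁆ = H) (hHD : ⁅H, D⁆ = (2 : K) • D)
    {b : A} {mu : K} (hb : H b = mu • b) (k : ℕ) :
    ∃ lam : K, (⇑D)^[k] (E (D b)) = E ((⇑D)^[k + 1] b) + lam • (⇑D)^[k] b := by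
  induction k with
  | zero => exact ⟨0, by simp⟩
  | succ k ih =>
    obtain ⟨lam, hlam⟩ := ih
    have h := DFunLike.congr_fun hDE ((⇑D)^[k + 1] b)
    rw [Derivation.commutator_apply, apply_iterate_eq_smul_of_lie_eq_two_smul hHD hb,
      sub_eq_iff_eq_add, ← Function.iterate_succ_apply' (⇑D)] at h
    refine ⟨mu + 2 * (k + 1 : ℕ) + lam, ?_⟩
    rw [Function.iterate_succ_apply', hlam, map_add, h, Derivation.map_smul,
      ← Function.iterate_succ_apply' (⇑D) k b, add_smul _ lam]
    simp only [Nat.succ_eq_add_one]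
    abel

end WeitzenboeckTriple

/-- For an isobaric polynomial `b` and every `s ≥ 2` there is `λ = λ(s) ∈ K` such that
`D^{s-1}(D̂(D(b))) = D̂(D^s(b)) + λ·D^{s-1}(b)`, where `D` is the basic Weitzenböck
derivation and `D̂` its opposite `sl_2`-partner. -/
theorem iterated_commutation_formula
    (K : Type*) [Field K] [CharZero K] (n : ℕ)
    (D Dhat H : Derivation K (MvPolynomial (Fin n) K) (MvPolynomial (Fin n) K))
    (hD : ∀ i : Fin n, D (X i) =
        if h : (i : ℕ) = 0 then 0 else X (⟨(i : ℕ) - 1, by omega⟩ : Fin n))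
    (hDhat : ∀ i : Fin n, Dhat (X i) =
        if h : (i : ℕ) + 1 < n
        then (((i : ℕ) + 1) * (n - ((i : ℕ) + 1)) : K) • X (⟨(i : ℕ) + 1, h⟩ : Fin n)
        else 0)
    (hH : ∀ i : Fin n, H (X i) = ((n : K) - 2 * ((i : ℕ) + 1) + 1) • X i)
    (b : MvPolynomial (Fin n) K) (mu : K) (hb : H b = mu • b)
    (s : ℕ) (hs : 2 ≤ s) :
    ∃ lam : K,
      (⇑D)^[s - 1] (Dhat (D b)) = Dhat ((⇑D)^[s] b) + lam • (⇑D)^[s - 1] b := by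
  have hHD : ⁅H, D⁆ = (2 : K) • D := by
    refine MvPolynomial.derivation_ext fun i => ?_
    rw [Derivation.commutator_apply, Derivation.smul_apply, hH, Derivation.map_smul, hD]
    split_ifs with h
    · simp
    · rw [hH, ← sub_smul, Nat.cast_sub (by omega : 1 ≤ (i : ℕ))]
      congr 1
      push_cast
      ring
  have hDE : ⁅D, Dhat⁆ = H := by
    refine MvPolynomial.derivation_ext fun i => ?_
    have hup : D (Dhat (X i)) = (((i : ℕ) + 1) * (n - ((i : ℕ) + 1)) : K) • X i := by
      rw [hDhat]
      split_ifs with h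
      · rw [Derivation.map_smul, hD, dif_neg (Nat.succ_ne_zero _)]
        rfl
      · have hn : (n : K) = (i : ℕ) + 1 := by
          exact_mod_cast congrArg (Nat.cast : ℕ → K) (by omega : n = (i : ℕ) + 1)
        simp [hn]
    have hdown : Dhat (D (X i)) = ((i : ℕ) * (n - (i : ℕ)) : K) • X i := by
      rw [hD]
      split_ifs with h
      · simp [h]
      · have hi : (i : ℕ) - 1 + 1 = i := by omega
        have hcast : (((i : ℕ) - 1 : ℕ) : K) + 1 = (i : ℕ) := by exact_mod_cast congrArg (Nat.cast : ℕ → K) hi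
        rw [hDhat, dif_pos (by simp only [hi]; exact i.isLt)]
        simp only [hcast, hi]
    rw [Derivation.commutator_apply, hup, hdown, hH, ← sub_smul]
    congr 1
    ring
  obtain ⟨k, rfl⟩ : ∃ k, s = k + 1 := ⟨s - 1, by omega⟩
  exact Derivation.exists_iterate_eq_add_smul_of_lie hDE hHD hb k
end

section
/- Let K be a field of characteristic zero, A = K[x_1,...,x_n], D the basic Weitzenböck derivation (D(x_1)=0, D(x_i)=x_{i-1} for i≥2), and D̂ the derivation with D̂(x_i)=i(n−i)x_{i+1} for i ≤ n−1, D̂(x_n)=0. Let a_1,...,a_k be a system of isobaric generators of A_1 = Ker D as a K-subalgebra of A, and let S_n = { D̂^{k_1}(a_{i_1}) · ... · D̂^{k_t}(a_{i_t}) : a_{i_j} ∈ {a_1,...,a_k}, k_j ≥ 0, k_1 + ... + k_t ≤ n−1 }. Then the centralizer C_{W_n(K)}(D) = {T ∈ Der_K(A) : [T,D] = 0} is a module over A_1 = Ker D, generated as an A_1-module by the finite set {D_s : s ∈ S_n}, where D_s = Σ_{i=1}^n D^{n-i}(s) ∂_i. -/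
section SlTwo

variable {K V : Type*} [Field K] [AddCommGroup V] [Module K V] {E F H : Module.End K V}

lemma weight_pow_apply (hHF : ∀ v, H (F v) = F (H v) - (2 : K) • F v)
    {μ : K} {v : V} (hv : H v = μ • v) (k : ℕ) :
    H ((F ^ k) v) = (μ - 2 * k) • (F ^ k) v := by
  induction k with
  | zero => simp [hv]
  | succ k ih =>
    rw [pow_succ', Module.End.mul_apply, hHF, ih, map_smul, ← sub_smul]
    congr 1
    push_cast
    ring

lemma raise_lower_pow_apply (hEF : ∀ v, E (F v) = F (E v) + H v)
    (hHF : ∀ v, H (F v) = F (H v) - (2 : K) • F v)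
    {μ : K} {v : V} (hv : H v = μ • v) (k : ℕ) :
    E ((F ^ (k + 1)) v) = (F ^ (k + 1)) (E v) + ((k + 1) * (μ - k)) • (F ^ k) v := by
  induction k with
  | zero => simp [hEF, hv]
  | succ k ih =>
    rw [pow_succ', Module.End.mul_apply, hEF, ih, weight_pow_apply hHF hv, map_add, map_smul,
      ← Module.End.mul_apply, ← pow_succ', ← Module.End.mul_apply F, ← pow_succ', add_assoc,
      ← add_smul]
    congr 2
    push_cast
    ring

lemma raise_pow_lower_pow_eq_zero (hEF : ∀ v, E (F v) = F (E v) + H v)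
    (hHF : ∀ v, H (F v) = F (H v) - (2 : K) • F v)
    {μ : K} {v : V} (hv : H v = μ • v) (hEv : E v = 0) (k : ℕ) :
    (E ^ (k + 1)) ((F ^ k) v) = 0 := by
  induction k with
  | zero => simpa using hEv
  | succ k ih =>
    rw [pow_succ, Module.End.mul_apply, raise_lower_pow_apply hEF hHF hv, hEv, map_zero, zero_add,
      map_smul, ih, smul_zero]

variable [CharZero K]

/-- If `F` is locally nilpotent, then `F * E` is injective on weights outside `ℕ`. -/
lemma eq_zero_of_lower_raise_eq_zero (hEF : ∀ v, E (F v) = F (E v) + H v)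
    (hHF : ∀ v, H (F v) = F (H v) - (2 : K) • F v)
    (hnil : ∀ v, ∃ N : ℕ, (F ^ N) v = 0)
    {μ : K} {v : V} (hv : H v = μ • v) (hμ : ∀ k : ℕ, μ ≠ k) (hFE : F (E v) = 0) : v = 0 := by
  obtain ⟨N, hN⟩ := hnil v
  induction N with
  | zero => simpa using hN
  | succ N ih =>
    refine ih ?_
    have h := raise_lower_pow_apply hEF hHF hv N
    rw [hN, map_zero, pow_succ, Module.End.mul_apply, hFE, map_zero, zero_add] at h
    exact (smul_eq_zero.mp h.symm).resolve_left
      (mul_ne_zero (Nat.cast_add_one_ne_zero N) (sub_ne_zero.mpr (hμ N)))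

/-- In a module where `F` is locally nilpotent, a weight vector killed by `E ^ m` is a sum of
vectors `F ^ j g_j` with `j < m` and `g_j` primitive. -/
lemma exists_primitive_decomposition (hEF : ∀ v, E (F v) = F (E v) + H v)
    (hHE : ∀ v, H (E v) = E (H v) + (2 : K) • E v)
    (hHF : ∀ v, H (F v) = F (H v) - (2 : K) • F v)
    (hnil : ∀ v, ∃ N : ℕ, (F ^ N) v = 0) (m : ℕ) :
    ∀ (μ : K) (v : V), H v = μ • v → (E ^ m) v = 0 →
      ∃ g : ℕ → V, (∀ j, E (g j) = 0) ∧ (∀ j : ℕ, H (g j) = (μ + 2 * j) • g j) ∧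
        v = ∑ j ∈ Finset.range m, (F ^ j) (g j) := by
  induction m with
  | zero =>
    intro μ v _ h
    exact ⟨0, by simp, by simp, by simpa using h⟩
  | succ m ih =>
    intro μ v hv h
    obtain ⟨g, hEg, hHg, hg⟩ := ih (μ + 2) (E v) (by rw [hHE, hv, map_smul, add_smul])
      (by rwa [pow_succ, Module.End.mul_apply] at h)
    set c : ℕ → K := fun j => (j + 1) * (μ + 2 + j) with hc
    set w : V := v - ∑ j ∈ Finset.range m, (F ^ (j + 1)) ((c j)⁻¹ • g j) with hw
    have hEFg (j : ℕ) : E ((F ^ (j + 1)) (g j)) = c j • (F ^ j) (g j) := by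
      rw [raise_lower_pow_apply hEF hHF (hHg j), hEg, map_zero, zero_add, hc]
      congr 1
      ring
    have hHw : H w = μ • w := by
      rw [hw, map_sub, hv, map_sum, smul_sub, Finset.smul_sum]
      congr 1
      refine Finset.sum_congr rfl fun j _ => ?_
      rw [map_smul, map_smul, weight_pow_apply hHF (hHg j), smul_comm]
      congr 2
      push_cast
      ring
    have hEw : E w = ∑ j ∈ Finset.range m, (1 - (c j)⁻¹ * c j) • (F ^ j) (g j) := by
      rw [hw, map_sub, hg, map_sum, ← Finset.sum_sub_distrib]
      refine Finset.sum_congr rfl fun j _ => ?_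
      rw [map_smul, map_smul, hEFg, smul_smul, sub_smul, one_smul]
    have hprim : E w = 0 := by
      by_cases hne : ∀ j ∈ Finset.range m, c j ≠ 0
      · rw [hEw]
        refine Finset.sum_eq_zero fun j hj => ?_
        rw [inv_mul_cancel₀ (hne j hj), sub_self, zero_smul]
      · push Not at hne
        obtain ⟨i, -, hi⟩ := hne
        have key (j : ℕ) (hj : c j = 0) : μ = -((j + 2 : ℕ) : K) := by
          have := (mul_eq_zero.mp hj).resolve_left (Nat.cast_add_one_ne_zero j)
          push_cast
          linear_combination this
        have hneg (j k : ℕ) : -((j + 2 : ℕ) : K) ≠ k := by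
          intro hjk
          have : ((k + (j + 2) : ℕ) : K) = 0 := by
            rw [Nat.cast_add, ← hjk, neg_add_cancel]
          exact absurd (Nat.cast_eq_zero.mp this) (by omega)
        have hw0 : w = 0 := by
          refine eq_zero_of_lower_raise_eq_zero hEF hHF hnil hHw
            (by rw [key i hi]; exact hneg i) ?_
          rw [hEw, map_sum]
          refine Finset.sum_eq_zero fun j _ => ?_
          rw [map_smul, ← Module.End.mul_apply, ← pow_succ']
          by_cases hj : c j = 0
          · have hμ := key j hj
            have h0 : (F ^ (j + 1)) (g j) = 0 := by
              refine eq_zero_of_lower_raise_eq_zero hEF hHF hnil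
                (weight_pow_apply hHF (hHg j) (j + 1)) ?_ (by rw [hEFg, hj, zero_smul, map_zero])
              convert hneg j using 3
              rw [hμ]
              push_cast
              ring
            rw [h0, smul_zero]
          · rw [inv_mul_cancel₀ hj, sub_self, zero_smul]
        rw [hw0, map_zero]
    refine ⟨fun j => j.casesOn w fun j => (c j)⁻¹ • g j, ?_, ?_, ?_⟩
    · rintro (_ | j)
      · exact hprim
      · simp [hEg]
    · rintro (_ | j)
      · simpa using hHw
      · change H ((c j)⁻¹ • g j) = _ • ((c j)⁻¹ • g j)
        rw [map_smul, hHg, smul_comm]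
        congr 1
        push_cast
        ring
    · rw [Finset.sum_range_succ']
      simp [hw]

/-- If `H` is diagonalizable, the weight restriction in `exists_primitive_decomposition`
can be dropped. -/
lemma exists_primitive_sum (hEF : ∀ v, E (F v) = F (E v) + H v)
    (hHE : ∀ v, H (E v) = E (H v) + (2 : K) • E v)
    (hHF : ∀ v, H (F v) = F (H v) - (2 : K) • F v)
    (hnil : ∀ v, ∃ N : ℕ, (F ^ N) v = 0)
    (hdiag : ⨆ μ, H.eigenspace μ = ⊤) (m : ℕ) (v : V) (hv : (E ^ m) v = 0) :
    ∃ g : ℕ → V, (∀ j, E (g j) = 0) ∧ v = ∑ j ∈ Finset.range m, (F ^ j) (g j) := by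
  classical
  obtain ⟨f, hf, rfl⟩ := (Submodule.mem_iSup_iff_exists_finsupp _ _).mp
    (hdiag ▸ Submodule.mem_top : v ∈ ⨆ μ, H.eigenspace μ)
  have hHf (μ : K) : H (f μ) = μ • f μ := Module.End.mem_eigenspace_iff.mp (hf μ)
  have hHE_pow (μ : K) : H ((E ^ m) (f μ)) = (μ + 2 * m) • (E ^ m) (f μ) := by
    clear hv
    induction m with
    | zero => simpa using hHf μ
    | succ m ih =>
      rw [pow_succ', Module.End.mul_apply, hHE, ih, map_smul, ← add_smul]
      congr 1
      push_cast
      ring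
  have hE (μ : K) : (E ^ m) (f μ) = 0 := by
    have hind := (iSupIndep_iff_finsetSum_eq_zero_imp_eq_zero _).mp
      ((Module.End.eigenspaces_iSupIndep H).comp (add_left_injective (2 * (m : K))))
    by_cases hμ : μ ∈ f.support
    · refine hind f.support (fun ν => (E ^ m) (f ν)) (fun ν _ => ?_) ?_ μ hμ
      · exact Module.End.mem_eigenspace_iff.mpr (hHE_pow ν)
      · rw [← map_sum]
        exact hv
    · simp [Finsupp.notMem_support_iff.mp hμ]
  choose g hEg _ hg using fun μ =>
    exists_primitive_decomposition hEF hHE hHF hnil m μ (f μ) (hHf μ) (hE μ)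
  refine ⟨fun j => ∑ μ ∈ f.support, g μ j, fun j => by simp [hEg], ?_⟩
  simp only [map_sum]
  rw [Finset.sum_comm, Finsupp.sum]
  exact Finset.sum_congr rfl fun μ _ => hg μ

end SlTwo

section Derivation

variable {K A : Type*} [Field K] [CommRing A] [Algebra K A] (δ : Derivation K A A)

lemma Derivation.iterate_mul_eq_zero_s13 (N : ℕ) :
    ∀ (k l : ℕ) (p q : A), δ^[k] p = 0 → δ^[l] q = 0 → k + l ≤ N + 1 → δ^[N] (p * q) = 0 := by
  induction N with
  | zero =>
    intro k l p q hp hq h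
    obtain rfl | rfl : k = 0 ∨ l = 0 := by omega
    all_goals simp_all
  | succ N ih =>
    rintro (_ | k) l p q hp hq h
    · rw [show p = 0 from hp, zero_mul, iterate_map_zero]
    obtain _ | l := l
    · rw [show q = 0 from hq, mul_zero, iterate_map_zero]
    rw [Function.iterate_succ_apply, δ.leibniz, iterate_map_add, smul_eq_mul, smul_eq_mul,
      ih (k + 1) l p (δ q) hp hq (by omega), ih (l + 1) k q (δ p) hq hp (by omega), add_zero]

lemma Derivation.iterate_prod_eq_zero {ι : Type*} (s : Finset ι) (d : ι → ℕ) (p : ι → A)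
    (h : ∀ i ∈ s, δ^[d i + 1] (p i) = 0) : δ^[∑ i ∈ s, d i + 1] (∏ i ∈ s, p i) = 0 := by
  classical
  induction s using Finset.induction_on with
  | empty => simp
  | insert i s hi ih =>
    rw [Finset.prod_insert hi, Finset.sum_insert hi]
    exact δ.iterate_mul_eq_zero_s13 _ _ _ _ _ (h i (Finset.mem_insert_self i s))
      (ih fun j hj => h j (Finset.mem_insert_of_mem hj)) (by omega)

lemma Derivation.iterate_eq_zero_of_le {k l : ℕ} {p : A} (h : δ^[k] p = 0) (hkl : k ≤ l) :
    δ^[l] p = 0 := by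
  obtain ⟨m, rfl⟩ := Nat.exists_eq_add_of_le' hkl
  rw [Function.iterate_add_apply, h, iterate_map_zero]

variable {δ} in
lemma Derivation.iterate_mul_of_apply_eq_zero {c : A} (hc : δ c = 0) (m : ℕ) (p : A) :
    δ^[m] (c * p) = c * δ^[m] p := by
  induction m with
  | zero => rfl
  | succ m ih =>
    rw [Function.iterate_succ_apply', ih, δ.leibniz, hc, smul_zero, add_zero, smul_eq_mul,
      Function.iterate_succ_apply']

variable {k : ℕ} (a : Fin k → A)

/-- Products of iterated `δ`-derivatives of the `a i`, of total order at most `m`; factors of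
order zero are left out. -/
def derivativeProducts (m : ℕ) : Set A :=
  {s | ∃ (t : ℕ) (idx : Fin t → Fin k) (ks : Fin t → ℕ), (∑ l, ks l) ≤ m ∧
    s = ∏ l, (if ks l = 0 then 1 else (⇑δ)^[ks l] (a (idx l)))}

/-- The span of `derivativeProducts` over the algebra generated by the `a i`. -/
def derivativeSpan (m : ℕ) : Submodule (Algebra.adjoin K (Set.range a)) A :=
  Submodule.span _ (derivativeProducts δ a m)

variable {δ a}

lemma derivativeSpan_mono {m l : ℕ} (h : m ≤ l) : derivativeSpan δ a m ≤ derivativeSpan δ a l :=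
  Submodule.span_mono fun _ ⟨t, idx, ks, hks, hs⟩ => ⟨t, idx, ks, hks.trans h, hs⟩

lemma one_mem_derivativeSpan (m : ℕ) : (1 : A) ∈ derivativeSpan δ a m :=
  Submodule.subset_span ⟨0, Fin.elim0, Fin.elim0, by simp, by simp⟩

lemma mem_derivativeSpan_of_mem_adjoin {c : A} (hc : c ∈ Algebra.adjoin K (Set.range a)) (m : ℕ) :
    c ∈ derivativeSpan δ a m := by
  simpa [Subalgebra.smul_def] using
    (derivativeSpan δ a m).smul_mem ⟨c, hc⟩ (one_mem_derivativeSpan m)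

lemma iterate_mem_derivativeSpan (i : Fin k) (m : ℕ) : δ^[m] (a i) ∈ derivativeSpan δ a m := by
  obtain _ | m := m
  · exact mem_derivativeSpan_of_mem_adjoin (Algebra.subset_adjoin ⟨i, rfl⟩) 0
  · exact Submodule.subset_span ⟨1, fun _ => i, fun _ => m + 1, by simp, by simp⟩

lemma mul_mem_derivativeSpan {m l : ℕ} {p q : A} (hp : p ∈ derivativeSpan δ a m)
    (hq : q ∈ derivativeSpan δ a l) : p * q ∈ derivativeSpan δ a (m + l) := by
  have h := Submodule.mul_mem_mul hp hq
  rw [derivativeSpan, derivativeSpan, Submodule.span_mul_span] at h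
  refine Submodule.span_mono ?_ h
  rintro _ ⟨_, ⟨t, idx, ks, hks, rfl⟩, _, ⟨t', idx', ks', hks', rfl⟩, rfl⟩
  refine ⟨t + t', Fin.append idx idx', Fin.append ks ks', ?_, ?_⟩
  · simpa [Fin.sum_univ_add] using add_le_add hks hks'
  · simp [Fin.prod_univ_add]

lemma apply_mem_derivativeSpan_of_mem_adjoin {c : A}
    (hc : c ∈ Algebra.adjoin K (Set.range a)) : δ c ∈ derivativeSpan δ a 1 := by
  induction hc using Algebra.adjoin_induction with
  | mem x hx =>
    obtain ⟨i, rfl⟩ := hx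
    exact iterate_mem_derivativeSpan i 1
  | algebraMap r => simp
  | add x y _ _ hx hy =>
    rw [map_add]
    exact add_mem hx hy
  | mul x y hx hy ihx ihy =>
    rw [δ.leibniz]
    exact add_mem ((derivativeSpan δ a 1).smul_mem ⟨x, hx⟩ ihy)
      ((derivativeSpan δ a 1).smul_mem ⟨y, hy⟩ ihx)

lemma prod_mem_derivativeSpan {ι : Type*} (s : Finset ι) (d : ι → ℕ) (p : ι → A)
    (hp : ∀ i ∈ s, p i ∈ derivativeSpan δ a (d i))
    (hδp : ∀ i ∈ s, δ (p i) ∈ derivativeSpan δ a (d i + 1)) :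
    ∏ i ∈ s, p i ∈ derivativeSpan δ a (∑ i ∈ s, d i) ∧
      δ (∏ i ∈ s, p i) ∈ derivativeSpan δ a (∑ i ∈ s, d i + 1) := by
  classical
  induction s using Finset.induction_on with
  | empty => simpa using one_mem_derivativeSpan 0
  | insert i s hi ih =>
    obtain ⟨h₁, h₂⟩ := ih (fun j hj => hp j (Finset.mem_insert_of_mem hj))
      fun j hj => hδp j (Finset.mem_insert_of_mem hj)
    have hpi := hp i (Finset.mem_insert_self i s)
    have hδpi := hδp i (Finset.mem_insert_self i s)
    rw [Finset.prod_insert hi, Finset.sum_insert hi, δ.leibniz]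
    refine ⟨mul_mem_derivativeSpan hpi h₁, add_mem ?_ ?_⟩
    · rw [add_assoc]
      exact mul_mem_derivativeSpan hpi h₂
    · rw [add_right_comm, add_comm]
      exact mul_mem_derivativeSpan h₁ hδpi

lemma apply_mem_derivativeSpan {m : ℕ} {p : A} (hp : p ∈ derivativeSpan δ a m) :
    δ p ∈ derivativeSpan δ a (m + 1) := by
  induction hp using Submodule.span_induction with
  | zero => simp
  | add x y _ _ hx hy =>
    rw [map_add]
    exact add_mem hx hy
  | smul c x hx ih =>
    rw [Subalgebra.smul_def, smul_eq_mul, δ.leibniz]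
    refine add_mem ((derivativeSpan δ a (m + 1)).smul_mem c ih) ?_
    exact mul_mem_derivativeSpan hx (apply_mem_derivativeSpan_of_mem_adjoin c.2)
  | mem x hx =>
    obtain ⟨t, idx, ks, hks, rfl⟩ := hx
    refine derivativeSpan_mono (Nat.succ_le_succ hks)
      (prod_mem_derivativeSpan Finset.univ ks _ (fun l _ => ?_) fun l _ => ?_).2
    · split_ifs
      · exact one_mem_derivativeSpan _
      · exact iterate_mem_derivativeSpan _ _
    · split_ifs
      · simp
      · rw [← Function.iterate_succ_apply' (⇑δ)]
        exact iterate_mem_derivativeSpan _ _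

lemma iterate_apply_mem_derivativeSpan {c : A} (hc : c ∈ Algebra.adjoin K (Set.range a)) (m : ℕ) :
    δ^[m] c ∈ derivativeSpan δ a m := by
  induction m with
  | zero => exact mem_derivativeSpan_of_mem_adjoin hc 0
  | succ m ih =>
    rw [Function.iterate_succ_apply']
    exact apply_mem_derivativeSpan ih

end Derivation

section MvPolynomial

open MvPolynomial

variable {K σ : Type*} [Field K]

lemma MvPolynomial.exists_iterate_derivation_eq_zero
    (δ : Derivation K (MvPolynomial σ K) (MvPolynomial σ K))
    (h : ∀ i, ∃ N : ℕ, δ^[N] (X i) = 0) (p : MvPolynomial σ K) : ∃ N : ℕ, δ^[N] p = 0 := by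
  induction p using MvPolynomial.induction_on with
  | C r => exact ⟨1, by simp⟩
  | add p q hp hq =>
    obtain ⟨k, hk⟩ := hp
    obtain ⟨l, hl⟩ := hq
    refine ⟨max k l, ?_⟩
    rw [iterate_map_add, δ.iterate_eq_zero_of_le hk (le_max_left k l),
      δ.iterate_eq_zero_of_le hl (le_max_right k l), add_zero]
  | mul_X p i hp =>
    obtain ⟨k, hk⟩ := hp
    obtain ⟨l, hl⟩ := h i
    exact ⟨k + l, δ.iterate_mul_eq_zero_s13 _ _ _ _ _ hk hl (Nat.le_succ _)⟩

lemma MvPolynomial.iSup_eigenspace_derivation_eq_top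
    (δ : Derivation K (MvPolynomial σ K) (MvPolynomial σ K)) (w : σ → K)
    (h : ∀ i, δ (X i) = w i • X i) :
    ⨆ μ, Module.End.eigenspace (δ : MvPolynomial σ K →ₗ[K] MvPolynomial σ K) μ = ⊤ := by
  have hmon (s : σ →₀ ℕ) (r : K) : ∃ μ : K, δ (monomial s r) = μ • monomial s r := by
    refine induction_on_monomial (motive := fun p => ∃ μ : K, δ p = μ • p)
      (fun r => ⟨0, by simp⟩) ?_ s r
    · rintro p i ⟨μ, hμ⟩
      refine ⟨w i + μ, ?_⟩
      rw [δ.leibniz, hμ, h, smul_eq_mul, smul_eq_mul, mul_smul_comm, mul_smul_comm,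
        mul_comm (X i), add_smul]
  refine eq_top_iff.mpr fun p _ => ?_
  induction p using MvPolynomial.induction_on' with
  | monomial s r =>
    obtain ⟨μ, hμ⟩ := hmon s r
    exact Submodule.mem_iSup_of_mem μ (Module.End.mem_eigenspace_iff.mpr hμ)
  | add p q hp hq => exact add_mem (hp trivial) (hq trivial)

lemma MvPolynomial.sum_smul_mkDerivation_apply_X {ι : Type*} [Fintype ι]
    (c : ι → MvPolynomial σ K) (f : ι → σ → MvPolynomial σ K) (i : σ) :
    (∑ j, c j • mkDerivation K (f j)) (X i) = ∑ j, c j * f j i := by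
  rw [← Derivation.coeFnAddMonoidHom_apply, map_sum, Finset.sum_apply]
  simp [Derivation.coeFnAddMonoidHom_apply, mkDerivation_X]

end MvPolynomial

section Weitzenbock

open MvPolynomial

variable {K : Type*} [Field K] {n : ℕ}
  {D Dhat H : Derivation K (MvPolynomial (Fin n) K) (MvPolynomial (Fin n) K)}

lemma iterate_weitzenbock_X
    (hD : ∀ i : Fin n, D (X i) =
      if _h : (i : ℕ) = 0 then 0 else X (⟨(i : ℕ) - 1, (Nat.sub_le i 1).trans_lt i.isLt⟩ : Fin n))
    (m : ℕ) (i : Fin n) (h : (i : ℕ) + m < n) : D^[m] (X ⟨i + m, h⟩) = X i := by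
  induction m with
  | zero => rfl
  | succ m ih =>
    rw [Function.iterate_succ_apply, hD, dif_neg (by simp)]
    exact ih (by omega)

lemma iterate_weitzenbock_opposite_X
    (hDhat : ∀ i : Fin n, Dhat (X i) =
      if h : (i : ℕ) + 1 < n
      then (((i : ℕ) + 1) * (n - ((i : ℕ) + 1)) : K) • X (⟨(i : ℕ) + 1, h⟩ : Fin n)
      else 0)
    (m : ℕ) : ∀ i : Fin n, n ≤ i + m → Dhat^[m] (X i) = 0 := by
  induction m with
  | zero => intro i hi; omega
  | succ m ih =>
    intro i hi
    rw [Function.iterate_succ_apply, hDhat]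
    split_ifs with h
    · rw [← Derivation.coeFn_coe, ← Module.End.pow_apply, map_smul, Module.End.pow_apply,
        Derivation.coeFn_coe, ih _ (by simp only; omega), smul_zero]
    · exact iterate_map_zero _ _

lemma weitzenbock_commutator
    (hD : ∀ i : Fin n, D (X i) =
      if _h : (i : ℕ) = 0 then 0 else X (⟨(i : ℕ) - 1, (Nat.sub_le i 1).trans_lt i.isLt⟩ : Fin n))
    (hDhat : ∀ i : Fin n, Dhat (X i) =
      if h : (i : ℕ) + 1 < n
      then (((i : ℕ) + 1) * (n - ((i : ℕ) + 1)) : K) • X (⟨(i : ℕ) + 1, h⟩ : Fin n)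
      else 0)
    (hH : ∀ i : Fin n, H (X i) = ((n : K) - 2 * ((i : ℕ) + 1) + 1) • X i) : ⁅D, Dhat⁆ = H := by
  refine derivation_ext fun i => ?_
  have h₁ : D (Dhat (X i)) = (((i : ℕ) + 1) * (n - ((i : ℕ) + 1)) : K) • X i := by
    rw [hDhat]
    split_ifs with h
    · rw [D.map_smul, hD, dif_neg (by simp)]
      rfl
    · have : (n : K) = (i : ℕ) + 1 :=
        (congrArg Nat.cast (by omega : n = (i : ℕ) + 1)).trans (Nat.cast_succ _)
      rw [this, sub_self, mul_zero, zero_smul, map_zero]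
  have h₂ : Dhat (D (X i)) = ((i : ℕ) * (n - (i : ℕ)) : K) • X i := by
    rw [hD]
    split_ifs with h
    · simp [h]
    · have hi : (i : ℕ) - 1 + 1 = i := by omega
      rw [hDhat, dif_pos (by simp only; omega)]
      simp only [hi]
      congr 2 <;> rw [← Nat.cast_add_one, hi]
  rw [Derivation.commutator_apply, h₁, h₂, hH, ← sub_smul]
  congr 1
  ring

lemma weitzenbock_weight_commutator
    (hD : ∀ i : Fin n, D (X i) =
      if _h : (i : ℕ) = 0 then 0 else X (⟨(i : ℕ) - 1, (Nat.sub_le i 1).trans_lt i.isLt⟩ : Fin n))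
    (hH : ∀ i : Fin n, H (X i) = ((n : K) - 2 * ((i : ℕ) + 1) + 1) • X i) :
    ⁅H, D⁆ = (2 : K) • D := by
  refine derivation_ext fun i => ?_
  rw [Derivation.commutator_apply, hH, D.map_smul, Derivation.smul_apply, hD]
  split_ifs with h
  · simp
  · rw [hH, ← sub_smul]
    congr 1
    simp only [Nat.cast_sub (show 1 ≤ (i : ℕ) by omega)]
    push_cast
    ring

lemma weitzenbock_opposite_weight_commutator
    (hDhat : ∀ i : Fin n, Dhat (X i) =
      if h : (i : ℕ) + 1 < n
      then (((i : ℕ) + 1) * (n - ((i : ℕ) + 1)) : K) • X (⟨(i : ℕ) + 1, h⟩ : Fin n)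
      else 0)
    (hH : ∀ i : Fin n, H (X i) = ((n : K) - 2 * ((i : ℕ) + 1) + 1) • X i) :
    ⁅H, Dhat⁆ = (-2 : K) • Dhat := by
  refine derivation_ext fun i => ?_
  rw [Derivation.commutator_apply, hH, Dhat.map_smul, Derivation.smul_apply, hDhat]
  split_ifs with h
  · rw [H.map_smul, hH, smul_smul, smul_smul, smul_smul, ← sub_smul]
    congr 1
    push_cast
    ring
  · simp

/-- A derivation commuting with the basic Weitzenböck derivation is determined by its value on
the last variable. -/
lemma commutes_weitzenbock_apply_X
    (hD : ∀ i : Fin n, D (X i) =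
      if _h : (i : ℕ) = 0 then 0 else X (⟨(i : ℕ) - 1, (Nat.sub_le i 1).trans_lt i.isLt⟩ : Fin n))
    {T : Derivation K (MvPolynomial (Fin n) K) (MvPolynomial (Fin n) K)}
    (hT : ∀ p, T (D p) = D (T p)) (hn : 0 < n) :
    D^[n] (T (X ⟨n - 1, by omega⟩)) = 0 ∧
      ∀ i : Fin n, T (X i) = D^[n - 1 - (i : ℕ)] (T (X ⟨n - 1, by omega⟩)) := by
  have hcomm (m : ℕ) (p : MvPolynomial (Fin n) K) : T (D^[m] p) = D^[m] (T p) :=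
    Function.Commute.iterate_right (f := ⇑T) (g := ⇑D) hT m p
  have hX (i : Fin n) : D^[n - 1 - (i : ℕ)] (X ⟨n - 1, by omega⟩) = X i := by
    have := iterate_weitzenbock_X hD (n - 1 - i) i (by omega)
    rwa [show (⟨i + (n - 1 - i), by omega⟩ : Fin n) = ⟨n - 1, by omega⟩ from
      Fin.ext (by simp only; omega)] at this
  refine ⟨?_, fun i => by rw [← hcomm, hX]⟩
  have h0 : D^[n] (X ⟨n - 1, by omega⟩) = 0 := by
    have := congrArg D (hX ⟨0, hn⟩)
    rwa [hD, dif_pos rfl, ← Function.iterate_succ_apply' (⇑D),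
      show (n - 1 - ((⟨0, hn⟩ : Fin n) : ℕ)).succ = n by simp only; omega] at this
  rw [← hcomm, h0, map_zero]

lemma sum_smul_mkDerivation_commutes_weitzenbock
    (hD : ∀ i : Fin n, D (X i) =
      if _h : (i : ℕ) = 0 then 0 else X (⟨(i : ℕ) - 1, (Nat.sub_le i 1).trans_lt i.isLt⟩ : Fin n))
    {m : ℕ} (c s : Fin m → MvPolynomial (Fin n) K) (hc : ∀ j, D (c j) = 0)
    (hs : ∀ j, D^[n] (s j) = 0) (p : MvPolynomial (Fin n) K) :
    (∑ j, c j • mkDerivation K (fun i : Fin n => D^[n - 1 - (i : ℕ)] (s j))) (D p) =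
      D ((∑ j, c j • mkDerivation K (fun i : Fin n => D^[n - 1 - (i : ℕ)] (s j))) p) := by
  set T := ∑ j, c j • mkDerivation K (fun i : Fin n => D^[n - 1 - (i : ℕ)] (s j)) with hT
  have hTX := sum_smul_mkDerivation_apply_X c fun j (i : Fin n) => D^[n - 1 - (i : ℕ)] (s j)
  rw [← hT] at hTX
  have hDTX (i : Fin n) : D (T (X i)) = ∑ j, c j * D^[n - 1 - (i : ℕ) + 1] (s j) := by
    rw [hTX, map_sum]
    refine Finset.sum_congr rfl fun j _ => ?_
    rw [D.leibniz, hc, smul_zero, add_zero, smul_eq_mul, Function.iterate_succ_apply']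
  have hbr : ⁅T, D⁆ = 0 := by
    refine derivation_ext fun i => ?_
    rw [Derivation.commutator_apply, Derivation.zero_apply, sub_eq_zero, hDTX, hD]
    split_ifs with h
    · rw [map_zero, Finset.sum_eq_zero]
      intro j _
      rw [show n - 1 - (i : ℕ) + 1 = n by omega, hs, mul_zero]
    · rw [hTX]
      refine Finset.sum_congr rfl fun j _ => ?_
      rw [show n - 1 - ((i : ℕ) - 1) = n - 1 - (i : ℕ) + 1 by omega]
  rw [← sub_eq_zero, ← Derivation.commutator_apply, hbr, Derivation.zero_apply]

end Weitzenbock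

open MvPolynomial


/-- Let `D` be the basic Weitzenböck derivation of `K[x_1,…,x_n]`, `D̂` its opposite
`sl_2`-partner, `a_1,…,a_k` isobaric generators of `Ker D`, and
`S_n = {D̂^{k_1}(a_{i_1})⋯D̂^{k_t}(a_{i_t}) : Σ k_j ≤ n−1}`. Then the centralizer of `D`
in `Der_K(A)` is generated as a `Ker D`-module by `{D_s : s ∈ S_n}`, where
`D_s = Σ_i D^{n-i}(s) ∂_i`. -/
theorem centralizer_weitzenbock_generators
    (K : Type*) [Field K] [CharZero K] (n : ℕ)
    (D Dhat H : Derivation K (MvPolynomial (Fin n) K) (MvPolynomial (Fin n) K))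
    (hD : ∀ i : Fin n, D (X i) =
        if h : (i : ℕ) = 0 then 0 else X (⟨(i : ℕ) - 1, by omega⟩ : Fin n))
    (hDhat : ∀ i : Fin n, Dhat (X i) =
        if h : (i : ℕ) + 1 < n
        then (((i : ℕ) + 1) * (n - ((i : ℕ) + 1)) : K) • X (⟨(i : ℕ) + 1, h⟩ : Fin n)
        else 0)
    (hH : ∀ i : Fin n, H (X i) = ((n : K) - 2 * ((i : ℕ) + 1) + 1) • X i)
    (k : ℕ) (a : Fin k → MvPolynomial (Fin n) K)
    (hiso : ∀ j, ∃ lam : K, H (a j) = lam • a j)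
    (hgen : ∀ f : MvPolynomial (Fin n) K,
        f ∈ Algebra.adjoin K (Set.range a) ↔ D f = 0) :
    ∀ T : Derivation K (MvPolynomial (Fin n) K) (MvPolynomial (Fin n) K),
      (∀ p, T (D p) = D (T p)) ↔
        ∃ (m : ℕ) (c : Fin m → MvPolynomial (Fin n) K)
          (s : Fin m → MvPolynomial (Fin n) K),
          (∀ j, D (c j) = 0) ∧
          (∀ j, ∃ (t : ℕ) (idx : Fin t → Fin k) (ks : Fin t → ℕ),
            (∑ l, ks l) ≤ n - 1 ∧
            s j = ∏ l, (if ks l = 0 then 1 else (⇑Dhat)^[ks l] (a (idx l)))) ∧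
          T = ∑ j, c j •
            MvPolynomial.mkDerivation K
              (fun i : Fin n => (⇑D)^[n - 1 - (i : ℕ)] (s j)) := by
  have hEF (p) : D (Dhat p) = Dhat (D p) + H p := by
    rw [← weitzenbock_commutator hD hDhat hH, Derivation.commutator_apply, add_sub_cancel]
  have hHE (p) : H (D p) = D (H p) + (2 : K) • D p := by
    rw [← Derivation.smul_apply, ← weitzenbock_weight_commutator hD hH,
      Derivation.commutator_apply, add_sub_cancel]
  have hHF (p) : H (Dhat p) = Dhat (H p) - (2 : K) • Dhat p := by
    rw [sub_eq_add_neg, ← neg_smul, ← Derivation.smul_apply,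
      ← weitzenbock_opposite_weight_commutator hDhat hH, Derivation.commutator_apply,
      add_sub_cancel]
  intro T
  constructor
  · intro hT
    rcases Nat.eq_zero_or_pos n with rfl | hn
    · exact ⟨0, Fin.elim0, Fin.elim0, fun j => j.elim0, fun j => j.elim0,
        derivation_ext fun i => i.elim0⟩
    obtain ⟨hf, hTX⟩ := commutes_weitzenbock_apply_X hD hT hn
    set f := T (X ⟨n - 1, by omega⟩)
    have hnil (p) : ∃ N : ℕ, (Dhat.toLinearMap ^ N) p = 0 := by
      simp only [Module.End.pow_apply]
      exact exists_iterate_derivation_eq_zero Dhat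
        (fun i => ⟨n, iterate_weitzenbock_opposite_X hDhat n i (by omega)⟩) p
    obtain ⟨g, hDg, hg⟩ := exists_primitive_sum (E := D.toLinearMap)
      (F := Dhat.toLinearMap) (H := H.toLinearMap) hEF hHE hHF
      hnil (iSup_eigenspace_derivation_eq_top H _ hH) n f (by rw [Module.End.pow_apply]; exact hf)
    have hmem : f ∈ derivativeSpan Dhat a (n - 1) := by
      rw [hg]
      refine sum_mem fun j hj => derivativeSpan_mono
        (Nat.le_sub_one_of_lt (Finset.mem_range.mp hj)) ?_
      rw [Module.End.pow_apply]
      exact iterate_apply_mem_derivativeSpan ((hgen _).mpr (hDg j)) j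
    obtain ⟨m, c, s, hcs⟩ := Submodule.mem_span_set'.mp hmem
    refine ⟨m, fun j => c j, fun j => s j, fun j => (hgen _).mp (c j).2, fun j => (s j).2, ?_⟩
    refine derivation_ext fun i => ?_
    rw [hTX, ← hcs, sum_smul_mkDerivation_apply_X, ← Derivation.coeFn_coe, ← Module.End.pow_apply,
      map_sum]
    refine Finset.sum_congr rfl fun j _ => ?_
    rw [Module.End.pow_apply, Derivation.coeFn_coe, Subalgebra.smul_def, smul_eq_mul,
      Derivation.iterate_mul_of_apply_eq_zero ((hgen _).mp (c j).2)]
  · rintro ⟨m, c, s, hc, hs, rfl⟩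
    rcases Nat.eq_zero_or_pos n with rfl | hn
    · have hD0 : D = 0 := derivation_ext fun i => i.elim0
      simp [hD0]
    refine sum_smul_mkDerivation_commutes_weitzenbock hD c s hc fun j => ?_
    obtain ⟨t, idx, ks, hks, h⟩ := hs j
    refine D.iterate_eq_zero_of_le (k := ∑ l, ks l + 1) ?_ (by omega)
    rw [h]
    refine D.iterate_prod_eq_zero _ _ _ fun l _ => ?_
    split_ifs with h0
    · simp [h0]
    · obtain ⟨lam, hlam⟩ := hiso (idx l)
      rw [← Derivation.coeFn_coe, ← Derivation.coeFn_coe, ← Module.End.pow_apply,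
        ← Module.End.pow_apply]
      exact raise_pow_lower_pow_eq_zero (E := D.toLinearMap)
        (F := Dhat.toLinearMap) (H := H.toLinearMap) hEF hHF hlam
        ((hgen _).mp (Algebra.subset_adjoin ⟨idx l, rfl⟩)) (ks l)
end

section
/- Let K be a field of characteristic zero, A a finitely generated integral domain over K, and D ≠ 0 a locally nilpotent K-derivation of A admitting a slice s ∈ A (i.e. D(s) = 1). Let C = Ker D and let Z = C_{Der_K A}(D) = {T ∈ Der_K(A) : [T,D] = 0} be the centralizer of D. Then: (1) M = {c·D : c ∈ C} is an abelian Lie ideal of Z; (2) L = {T ∈ Z : T(s) = 0} is a Lie subalgebra of Z; (3) Z = M ⊕ L as K-vector spaces; (4) the restriction map T ↦ T|_C is a Lie algebra isomorphism from L onto Der_K(C). Consequently Z is isomorphic to the semidirect sum of the abelian Lie algebra C and Der_K(C) with its natural action. -/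
/-- The kernel of a derivation, as a subalgebra. -/
def derivationKernel {K A : Type*} [CommRing K] [CommRing A] [Algebra K A]
    (D : Derivation K A A) : Subalgebra K A where
  carrier := {a | D a = 0}
  mul_mem' := by
    intro a b ha hb
    simp only [Set.mem_setOf_eq] at *
    rw [D.leibniz, ha, hb, smul_zero, smul_zero, add_zero]
  add_mem' := by
    intro a b ha hb
    simp only [Set.mem_setOf_eq] at *
    rw [map_add, ha, hb, add_zero]
  algebraMap_mem' := fun r => by
    simp only [Set.mem_setOf_eq, Derivation.map_algebraMap]

section Slice

open Polynomial

/-- The derivation of `R[X]` that applies a derivation of `R` to each coefficient. -/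
noncomputable def Derivation.mapPolynomial {K R : Type*} [CommRing K] [CommRing R] [Algebra K R]
    (δ : Derivation K R R) : Derivation K R[X] R[X] :=
  PolynomialModule.equivPolynomialSelf.compDer δ.mapCoeffs

theorem Derivation.coeff_mapPolynomial {K R : Type*} [CommRing K] [CommRing R] [Algebra K R]
    (δ : Derivation K R R) (p : R[X]) (n : ℕ) :
    (δ.mapPolynomial p).coeff n = δ (p.coeff n) :=
  rfl

theorem Derivation.mapPolynomial_C {K R : Type*} [CommRing K] [CommRing R] [Algebra K R]
    (δ : Derivation K R R) (c : R) : δ.mapPolynomial (C c) = C (δ c) := by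
  ext n
  rw [coeff_mapPolynomial, coeff_C, coeff_C]
  split_ifs <;> simp

theorem Derivation.mapPolynomial_X {K R : Type*} [CommRing K] [CommRing R] [Algebra K R]
    (δ : Derivation K R R) : δ.mapPolynomial X = 0 := by
  ext n
  rw [coeff_mapPolynomial, coeff_X]
  split_ifs <;> simp

theorem Derivation.mapPolynomial_derivative {K R : Type*} [CommRing K] [CommRing R] [Algebra K R]
    (δ : Derivation K R R) (p : R[X]) :
    δ.mapPolynomial (derivative p) = derivative (δ.mapPolynomial p) := by
  ext n
  rw [coeff_mapPolynomial, coeff_derivative, coeff_derivative, coeff_mapPolynomial,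
    ← Nat.cast_succ, δ.leibniz, Derivation.map_natCast, smul_zero, zero_add, smul_eq_mul, mul_comm]

/-- Over a `ℚ`-algebra, every polynomial has an antiderivative. -/
theorem Polynomial.derivative_surjective {R : Type*} [CommRing R] [Algebra ℚ R] :
    Function.Surjective (derivative : R[X] →ₗ[R] R[X]) := by
  intro p
  induction p using Polynomial.induction_on' with
  | add p q hp hq =>
    obtain ⟨p', rfl⟩ := hp
    obtain ⟨q', rfl⟩ := hq
    exact ⟨p' + q', map_add _ _ _⟩
  | monomial n c =>
    refine ⟨monomial (n + 1) (c * algebraMap ℚ R (1 / (n + 1))), ?_⟩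
    have h : algebraMap ℚ R (1 / (n + 1)) * ((n + 1 : ℕ) : R) = 1 := by
      rw [← map_natCast (algebraMap ℚ R), ← map_mul, ← map_one (algebraMap ℚ R)]
      congr 1
      push_cast
      field_simp
    rw [derivative_monomial, mul_assoc, h, mul_one, Nat.add_sub_cancel]

variable {K A : Type*} [Field K] [CommRing A] [Algebra K A] {D : Derivation K A A}
  {s : A}

theorem apply_aeval_derivationKernel (hs : D s = 1) (p : (derivationKernel D)[X]) :
    D (aeval s p) = aeval s (derivative p) := by
  induction p using Polynomial.induction_on' with
  | add p q hp hq => simp only [map_add, hp, hq]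
  | monomial n c =>
    have hc : D (c : A) = 0 := c.2
    simp [aeval_monomial, derivative_monomial, D.leibniz, D.leibniz_pow, hc, hs]
    ring

theorem aeval_slice_injective [CharZero K] (hs : D s = 1) :
    Function.Injective (aeval s : (derivationKernel D)[X] →ₐ[derivationKernel D] A) := by
  let _ : Algebra ℚ (derivationKernel D) := Algebra.compHom _ (algebraMap ℚ K)
  have : IsAddTorsionFree (derivationKernel D) := IsAddTorsionFree.of_module_rat _
  rw [injective_iff_map_eq_zero]
  intro p
  induction h : p.natDegree using Nat.strong_induction_on generalizing p with
  | _ n ih =>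
    intro hp
    have hp' : aeval s (derivative p) = 0 := by
      rw [← apply_aeval_derivationKernel hs, hp, map_zero]
    have hd : derivative p = 0 := by
      by_cases h0 : p.natDegree = 0
      · exact derivative_of_natDegree_zero h0
      · exact ih _ (h ▸ natDegree_derivative_lt h0) _ rfl hp'
    rw [eq_C_of_derivative_eq_zero hd] at hp ⊢
    rw [aeval_C] at hp
    have hc : p.coeff 0 = 0 := Subtype.ext hp
    rw [hc, C_0]

theorem aeval_slice_surjective [CharZero K] (hln : ∀ a : A, ∃ k : ℕ, (⇑D)^[k] a = 0)
    (hs : D s = 1) :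
    Function.Surjective (aeval s : (derivationKernel D)[X] →ₐ[derivationKernel D] A) := by
  let _ : Algebra ℚ (derivationKernel D) := Algebra.compHom _ (algebraMap ℚ K)
  intro a
  obtain ⟨k, hk⟩ := hln a
  induction k generalizing a with
  | zero => exact ⟨0, by simpa using hk.symm⟩
  | succ k ih =>
    obtain ⟨p, hp⟩ := ih (D a) hk
    obtain ⟨q, rfl⟩ := derivative_surjective p
    have hc : D (a - aeval s q) = 0 := by
      rw [map_sub, apply_aeval_derivationKernel hs, hp, sub_self]
    refine ⟨q + C ⟨a - aeval s q, hc⟩, ?_⟩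
    rw [map_add, aeval_C]
    exact add_sub_cancel _ _

theorem derivation_ext_of_slice [CharZero K] (hln : ∀ a : A, ∃ k : ℕ, (⇑D)^[k] a = 0)
    (hs : D s = 1) {T T' : Derivation K A A} (hT : T s = T' s)
    (h : ∀ c : A, D c = 0 → T c = T' c) : T = T' := by
  ext a
  obtain ⟨p, rfl⟩ := aeval_slice_surjective hln hs a
  induction p using Polynomial.induction_on' with
  | add p q hp hq => simp only [map_add, hp, hq]
  | monomial n c =>
    have hc : T (algebraMap (derivationKernel D) A c) = T' (algebraMap (derivationKernel D) A c) :=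
      h c c.2
    simp only [aeval_monomial, Derivation.leibniz, Derivation.leibniz_pow, hc, hT]

/-- A derivation of the kernel of `D` extends to a derivation commuting with `D` and killing
the slice. -/
theorem exists_extension_of_slice [CharZero K] (hln : ∀ a : A, ∃ k : ℕ, (⇑D)^[k] a = 0)
    (hs : D s = 1) (δ : Derivation K (derivationKernel D) (derivationKernel D)) :
    ∃ T : Derivation K A A, ⁅T, D⁆ = 0 ∧ T s = 0 ∧
      ∀ (c : A) (hc : D c = 0), T c = ↑(δ ⟨c, hc⟩) := by
  let e : (derivationKernel D)[X] ≃ₐ[derivationKernel D] A :=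
    AlgEquiv.ofBijective (aeval s) ⟨aeval_slice_injective hs, aeval_slice_surjective hln hs⟩
  let eK := e.restrictScalars K
  let T : Derivation K A A :=
    Derivation.mk' (eK.toLinearMap ∘ₗ δ.mapPolynomial.toLinearMap ∘ₗ eK.symm.toLinearMap) <| by
      intro a b
      change eK (δ.mapPolynomial (eK.symm (a * b))) =
        a • eK (δ.mapPolynomial (eK.symm b)) + b • eK (δ.mapPolynomial (eK.symm a))
      simp [Derivation.leibniz]
  have hT (p : (derivationKernel D)[X]) : T (aeval s p) = aeval s (δ.mapPolynomial p) := by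
    change eK (δ.mapPolynomial (eK.symm (eK p))) = eK (δ.mapPolynomial p)
    rw [AlgEquiv.symm_apply_apply]
  refine ⟨T, ?_, ?_, fun c hc ↦ ?_⟩
  · ext a
    obtain ⟨p, rfl⟩ := aeval_slice_surjective hln hs a
    rw [Derivation.commutator_apply, apply_aeval_derivationKernel hs, hT, hT,
      apply_aeval_derivationKernel hs, Derivation.mapPolynomial_derivative, sub_self,
      Derivation.zero_apply]
  · simpa [Derivation.mapPolynomial_X] using hT X
  · have h := hT (C ⟨c, hc⟩)
    rwa [Derivation.mapPolynomial_C, aeval_C, aeval_C] at h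

end Slice

theorem Derivation.apply_comm_of_lie_eq_zero {K A : Type*} [CommRing K] [CommRing A] [Algebra K A]
    {T D : Derivation K A A} (h : ⁅T, D⁆ = 0) (a : A) : T (D a) = D (T a) := by
  rw [← sub_eq_zero, ← commutator_apply, h, zero_apply]

theorem Derivation.lie_smul_self_of_lie_eq_zero {K A : Type*} [CommRing K] [CommRing A]
    [Algebra K A] {T D : Derivation K A A} (h : ⁅T, D⁆ = 0) (c : A) :
    ⁅T, c • D⁆ = T c • D := by
  ext a
  simp only [commutator_apply, smul_apply, smul_eq_mul, leibniz, apply_comm_of_lie_eq_zero h]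
  ring

/-- Structure of the centralizer `Z` of a locally nilpotent derivation `D` with a slice `s`
on a finitely generated domain `A`: (1) `M = {c·D : c ∈ Ker D}` is an abelian Lie ideal of
`Z`; (2) `L = {T ∈ Z : T(s) = 0}` is a Lie subalgebra; (3) `Z = M ⊕ L`; (4) restriction to
`C = Ker D` is a Lie algebra isomorphism from `L` onto `Der_K(C)`. Consequently
`Z ≃ C ⋊ Der_K(C)`. -/
theorem centralizer_of_locally_nilpotent_with_slice
    (K A : Type*) [Field K] [CharZero K] [CommRing A] [IsDomain A]
    [Algebra K A] [Algebra.FiniteType K A]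
    (D : Derivation K A A) (hD0 : D ≠ 0)
    (hln : ∀ a : A, ∃ k : ℕ, (⇑D)^[k] a = 0)
    (s : A) (hs : D s = 1) :
    -- (1) M is an abelian Lie ideal of Z
    (∀ c c' : A, D c = 0 → D c' = 0 → ⁅c • D, c' • D⁆ = (0 : Derivation K A A)) ∧
    (∀ T : Derivation K A A, ⁅T, D⁆ = 0 → ∀ c : A, D c = 0 →
        ∃ c' : A, D c' = 0 ∧ ⁅T, c • D⁆ = c' • D) ∧
    -- (2) L is a Lie subalgebra of Z
    (∀ T T' : Derivation K A A, ⁅T, D⁆ = 0 → T s = 0 → ⁅T', D⁆ = 0 → T' s = 0 →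
        ⁅⁅T, T'⁆, D⁆ = 0 ∧ ⁅T, T'⁆ s = 0) ∧
    -- (3) Z = M ⊕ L as K-vector spaces
    (∀ T : Derivation K A A, ⁅T, D⁆ = 0 →
        ∃! p : A × Derivation K A A,
          D p.1 = 0 ∧ ⁅p.2, D⁆ = 0 ∧ p.2 s = 0 ∧ T = p.1 • D + p.2) ∧
    -- (4) restriction to C = Ker D is a Lie isomorphism from L onto Der_K(C):
    -- C is invariant, restriction is injective on L, surjective onto Der_K(C),
    -- and compatible with brackets
    (∀ T : Derivation K A A, ⁅T, D⁆ = 0 → ∀ c : A, D c = 0 → D (T c) = 0) ∧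
    (∀ T T' : Derivation K A A, ⁅T, D⁆ = 0 → T s = 0 → ⁅T', D⁆ = 0 → T' s = 0 →
        (∀ c : A, D c = 0 → T c = T' c) → T = T') ∧
    (∀ δ : Derivation K (derivationKernel D) (derivationKernel D),
        ∃ T : Derivation K A A, ⁅T, D⁆ = 0 ∧ T s = 0 ∧
          ∀ (c : A) (hc : D c = 0), T c = ↑(δ ⟨c, hc⟩)) ∧
    (∀ T T' : Derivation K A A, ⁅T, D⁆ = 0 → T s = 0 → ⁅T', D⁆ = 0 → T' s = 0 →
        ∀ c : A, D c = 0 → ⁅T, T'⁆ c = T (T' c) - T' (T c)) := by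
  have apply_mem {T : Derivation K A A} (hT : ⁅T, D⁆ = 0) {c : A} (hc : D c = 0) :
      D (T c) = 0 := by
    rw [← Derivation.apply_comm_of_lie_eq_zero hT, hc, map_zero]
  have apply_slice_mem {T : Derivation K A A} (hT : ⁅T, D⁆ = 0) : D (T s) = 0 := by
    rw [← Derivation.apply_comm_of_lie_eq_zero hT, hs, Derivation.map_one_eq_zero]
  refine ⟨fun c c' hc hc' ↦ ?_,
    fun T hT c hc ↦ ⟨T c, apply_mem hT hc, Derivation.lie_smul_self_of_lie_eq_zero hT c⟩,
    fun T T' hT hTs hT' hTs' ↦ ⟨?_, ?_⟩, fun T hT ↦ ?_, fun T hT c hc ↦ apply_mem hT hc,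
    fun T T' _ hTs _ hTs' h ↦ derivation_ext_of_slice hln hs (hTs.trans hTs'.symm) h,
    exists_extension_of_slice hln hs, fun _ _ _ _ _ _ _ _ ↦ rfl⟩
  · ext a
    simp only [Derivation.commutator_apply, Derivation.smul_apply, smul_eq_mul,
      Derivation.leibniz, hc, hc', Derivation.zero_apply]
    ring
  · rw [lie_lie, hT, hT', lie_zero, lie_zero, sub_zero]
  · rw [Derivation.commutator_apply, hTs, hTs', map_zero, map_zero, sub_zero]
  · refine ⟨(T s, T - T s • D), ⟨apply_slice_mem hT, ?_, ?_, ?_⟩, ?_⟩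
    · rw [sub_lie, hT, ← lie_skew, Derivation.lie_smul_self_of_lie_eq_zero (lie_self D),
        apply_slice_mem hT, zero_smul, neg_zero, sub_zero]
    · simp [hs]
    · simp
    · rintro ⟨c, T'⟩ ⟨-, -, hTs', rfl⟩
      simp only at hTs'
      simp [hs, hTs']
end

section
/- Let K be a field of characteristic zero, A a finitely generated integral domain over K with transcendence degree n over K, and D ≠ 0 a locally nilpotent K-derivation of A. Let R = Frac(A) be the fraction field of A, and extend each derivation T ∈ Der_K(A) uniquely to a derivation of R. Then the R-vector subspace of Der_K(R) spanned by the extensions of the elements of the centralizer C_{Der_K A}(D) = {T ∈ Der_K(A) : [T,D] = 0} has dimension exactly n over R; that is, the rank of C_{Der_K A}(D) over A equals n = tr.deg_K(A). -/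
/-- A derivation extends uniquely along a formally étale algebra. -/
theorem Derivation.existsUnique_extension_of_formallyEtale {R S T M : Type*} [CommRing R]
    [CommRing S] [CommRing T] [Algebra R S] [Algebra R T] [Algebra S T] [IsScalarTower R S T]
    [Algebra.FormallyEtale S T] [AddCommGroup M] [Module R M] [Module S M] [Module T M]
    [IsScalarTower R S M] [IsScalarTower R T M] [IsScalarTower S T M] (d : Derivation R S M) :
    ∃! d' : Derivation R T M, ∀ s, d' (algebraMap S T s) = d s := by
  have h := KaehlerDifferential.isBaseChange_of_formallyEtale R S T
  refine ⟨(h.lift d.liftKaehlerDifferential).compDer (KaehlerDifferential.D R T),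
    fun s ↦ ?_, fun d' hd' ↦ ?_⟩
  · have := h.lift_eq d.liftKaehlerDifferential (KaehlerDifferential.D R S s)
    simpa using this
  · have key : d'.liftKaehlerDifferential = h.lift d.liftKaehlerDifferential := by
      refine h.algHom_ext _ _ fun ω ↦ ?_
      rw [h.lift_eq]
      have hω : ω ∈ Submodule.span S (Set.range (KaehlerDifferential.D R S)) := by
        rw [KaehlerDifferential.span_range_derivation]; trivial
      induction hω using Submodule.span_induction with
      | mem _ hx => obtain ⟨s, rfl⟩ := hx; simp [hd']
      | zero => simp
      | add _ _ _ _ hx hy => simp [hx, hy]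
      | smul a _ _ hx => simp only [LinearMap.map_smul_of_tower, hx]
    ext t
    simp [← key]

/-- In characteristic zero, a field is formally étale over the polynomial ring on a
transcendence basis. -/
theorem IsTranscendenceBasis.formallyEtale {ι K L : Type*} [Field K] [CharZero K] [Field L]
    [Algebra K L] {y : ι → L} (hy : IsTranscendenceBasis K y)
    [Algebra (MvPolynomial ι K) L] (h : ∀ p, algebraMap (MvPolynomial ι K) L p =
      MvPolynomial.aeval y p) :
    Algebra.FormallyEtale (MvPolynomial ι K) L := by
  have hinj : Function.Injective (algebraMap (MvPolynomial ι K) L) := by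
    intro p q hpq
    exact hy.1 (by simpa only [h] using hpq)
  have : FaithfulSMul (MvPolynomial ι K) L := (faithfulSMul_iff_algebraMap_injective _ _).2 hinj
  have : IsScalarTower K (MvPolynomial ι K) L := .of_algebraMap_eq fun k ↦ by
    rw [h, MvPolynomial.algebraMap_eq, MvPolynomial.aeval_C]
  have : Algebra.IsAlgebraic (MvPolynomial ι K) L := by
    have := hy.isAlgebraic
    let e := hy.1.aevalEquiv
    let _ : Algebra (Algebra.adjoin K (Set.range y)) (MvPolynomial ι K) :=
      e.symm.toRingHom.toAlgebra
    have : IsScalarTower (Algebra.adjoin K (Set.range y)) (MvPolynomial ι K) L :=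
      .of_algebraMap_eq fun p ↦ by
        rw [h]
        obtain ⟨q, rfl⟩ := e.surjective p
        exact (hy.1.algebraMap_aevalEquiv q).trans
          (congrArg (MvPolynomial.aeval y) (e.symm_apply_apply q).symm)
    exact .extendScalars e.symm.injective
  let F := FractionRing (MvPolynomial ι K)
  let _ : Algebra F L := FractionRing.liftAlgebra (MvPolynomial ι K) L
  have : IsScalarTower (MvPolynomial ι K) F L := FractionRing.isScalarTower_liftAlgebra _ _
  have : Algebra.IsAlgebraic F L := .extendScalars (IsFractionRing.injective (MvPolynomial ι K) F)
  have : CharZero F := charZero_of_injective_algebraMap (algebraMap K F).injective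
  have : Algebra.FormallyEtale F L := Algebra.FormallyEtale.of_isSeparable F L
  have : Algebra.FormallyEtale (MvPolynomial ι K) F :=
    .of_isLocalization (nonZeroDivisors (MvPolynomial ι K))
  exact .comp _ F _

/-- In characteristic zero, the derivations of a field are freely determined by their values
on a transcendence basis. -/
theorem IsTranscendenceBasis.existsUnique_derivation {ι K L : Type*} [Field K] [CharZero K]
    [Field L] [Algebra K L] {y : ι → L} (hy : IsTranscendenceBasis K y) (v : ι → L) :
    ∃! d : Derivation K L L, ∀ i, d (y i) = v i := by
  let _ : Algebra (MvPolynomial ι K) L := (MvPolynomial.aeval y).toAlgebra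
  have h : ∀ p, algebraMap (MvPolynomial ι K) L p = MvPolynomial.aeval y p := fun _ ↦ rfl
  have : IsScalarTower K (MvPolynomial ι K) L := .of_algebraMap_eq fun k ↦ by
    rw [h, MvPolynomial.algebraMap_eq, MvPolynomial.aeval_C]
  have := hy.formallyEtale h
  obtain ⟨d, hd, hu⟩ := Derivation.existsUnique_extension_of_formallyEtale (T := L)
    (MvPolynomial.mkDerivation K v)
  refine ⟨d, fun i ↦ ?_, fun d' hd' ↦ hu d' fun p ↦ ?_⟩
  · simpa [h] using hd (MvPolynomial.X i)
  · have : d'.compAlgebraMap (MvPolynomial ι K) = MvPolynomial.mkDerivation K v :=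
      MvPolynomial.derivation_ext fun i ↦ by simp [h, hd']
    exact DFunLike.congr_fun this p

/-- The constants of a derivation of a field. -/
def Derivation.constants {K L : Type*} [Field K] [Field L] [Algebra K L]
    (δ : Derivation K L L) : IntermediateField K L where
  carrier := {a | δ a = 0}
  mul_mem' {a b} (ha : δ a = 0) (hb : δ b = 0) := by simp [ha, hb]
  add_mem' {a b} (ha : δ a = 0) (hb : δ b = 0) := by simp [ha, hb]
  algebraMap_mem' := δ.map_algebraMap
  inv_mem' a (ha : δ a = 0) := by simp [Derivation.leibniz_inv, ha]

theorem Derivation.mem_constants {K L : Type*} [Field K] [Field L] [Algebra K L]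
    {δ : Derivation K L L} {a : L} : a ∈ δ.constants ↔ δ a = 0 := Iff.rfl

/-- A derivation of a field, regarded as linear over its constants. -/
def Derivation.overConstants {K L : Type*} [Field K] [Field L] [Algebra K L]
    (δ : Derivation K L L) : Derivation δ.constants L L :=
  Derivation.mk'
    { toFun := δ
      map_add' := map_add δ
      map_smul' := fun c a ↦ by
        have := mem_constants.1 c.2
        simp [IntermediateField.smul_def, this] } fun a b ↦ δ.leibniz a b

theorem Derivation.overConstants_apply {K L : Type*} [Field K] [Field L] [Algebra K L]
    (δ : Derivation K L L) (a : L) : δ.overConstants a = δ a := rfl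

theorem Derivation.mem_adjoin_of_iterate_eq_zero {K L : Type*} [Field K] [Field L] [CharZero L]
    [Algebra K L] (δ : Derivation K L L) {x : L} (hx : δ x = 1) (k : ℕ) {a : L}
    (ha : (⇑δ)^[k] a = 0) : a ∈ Algebra.adjoin δ.constants {x} := by
  have integrate : ∀ p ∈ Algebra.adjoin δ.constants {x},
      ∃ q ∈ Algebra.adjoin δ.constants {x}, δ q = p := by
    intro p hp
    rw [Algebra.adjoin_singleton_eq_range_aeval] at hp
    obtain ⟨p, rfl⟩ := hp
    induction p using Polynomial.induction_on' with
    | add p q hp hq =>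
      obtain ⟨p', hp', hp⟩ := hp
      obtain ⟨q', hq', hq⟩ := hq
      exact ⟨p' + q', add_mem hp' hq', by simp_all⟩
    | monomial m c =>
      have hm : ((m : L) + 1) ≠ 0 := by exact_mod_cast m.succ_ne_zero
      have hc : δ c = 0 := mem_constants.1 c.2
      refine ⟨(c / ((m + 1 : ℕ) : δ.constants) : δ.constants) • x ^ (m + 1),
        Subalgebra.smul_mem _ (pow_mem (Algebra.self_mem_adjoin_singleton _ _) _) _, ?_⟩
      rw [← overConstants_apply, Derivation.map_smul, Derivation.leibniz_pow,
        overConstants_apply, hx]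
      simp [Algebra.smul_def, Polynomial.aeval_monomial]
      field_simp
  induction k generalizing a with
  | zero => simp_all
  | succ k ih =>
    obtain ⟨q, hq, hqa⟩ := integrate (δ a) (ih ha)
    have hc : a - q ∈ δ.constants := by rw [mem_constants, map_sub, hqa, sub_self]
    have := add_mem (Subalgebra.algebraMap_mem (Algebra.adjoin δ.constants {x}) ⟨a - q, hc⟩) hq
    simpa using this

theorem Derivation.transcendental_of_apply_eq_one {K L : Type*} [Field K] [Field L] [CharZero L]
    [Algebra K L] (δ : Derivation K L L) {x : L} (hx : δ x = 1) :
    Transcendental δ.constants x := by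
  intro halg
  have hsep := (minpoly.irreducible halg.isIntegral).separable
  refine hsep.aeval_derivative_ne_zero (minpoly.aeval _ x) ?_
  have := δ.overConstants.map_aeval (minpoly δ.constants x) x
  rw [minpoly.aeval, map_zero, overConstants_apply, hx] at this
  simpa using this.symm

/-- If `δ x = 1` and `L` is the fraction field of a ring on which `δ` is locally nilpotent, then
`x` is a transcendence basis of `L` over the constants of `δ`. -/
theorem Derivation.isTranscendenceBasis_of_apply_eq_one {K A L : Type*} [Field K] [CommRing A]
    [Field L] [CharZero L] [Algebra K L] [Algebra A L] [IsFractionRing A L]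
    (δ : Derivation K L L) {x : L} (hx : δ x = 1)
    (hln : ∀ a : A, ∃ k : ℕ, (⇑δ)^[k] (algebraMap A L a) = 0) :
    IsTranscendenceBasis δ.constants (fun _ : Unit ↦ x) := by
  have hind : AlgebraicIndependent δ.constants (fun _ : Unit ↦ x) :=
    (algebraicIndependent_unique_type_iff).2 (δ.transcendental_of_apply_eq_one hx)
  rw [hind.isTranscendenceBasis_iff_isAlgebraic]
  have halg (a : A) : IsAlgebraic (Algebra.adjoin δ.constants (Set.range fun _ : Unit ↦ x))
      (algebraMap A L a) := by
    obtain ⟨k, hk⟩ := hln a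
    have := δ.mem_adjoin_of_iterate_eq_zero hx k hk
    rw [← Set.range_const (ι := Unit)] at this
    exact isAlgebraic_algebraMap (⟨_, this⟩ : Algebra.adjoin δ.constants _)
  refine ⟨fun r ↦ ?_⟩
  obtain ⟨a, b, -, rfl⟩ := IsFractionRing.div_surjective (A := A) r
  rw [div_eq_mul_inv]
  exact (halg a).mul (halg b).inv

/-- For a locally nilpotent map, some iterate of a nonzero element is a nonzero element of the
kernel. -/
theorem exists_iterate_ne_zero_of_locally_nilpotent {A : Type*} [Zero A] {f : A → A} {a : A}
    (ha : a ≠ 0) (hln : ∃ k : ℕ, f^[k] a = 0) : ∃ m : ℕ, f^[m] a ≠ 0 ∧ f (f^[m] a) = 0 := by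
  classical
  obtain ⟨m, hm⟩ : ∃ m, Nat.find hln = m + 1 := Nat.exists_eq_succ_of_ne_zero fun h ↦ by
    have := Nat.find_spec hln
    rw [h] at this
    exact ha this
  refine ⟨m, Nat.find_min hln (by omega), ?_⟩
  have := Nat.find_spec hln
  rwa [hm, Function.iterate_succ_apply'] at this

/-- A derivation of the fraction field of a finitely generated domain has bounded
denominators. -/
theorem Derivation.exists_ne_zero_forall_isInteger {K A L : Type*} [Field K] [CommRing A]
    [IsDomain A] [Algebra K A] [Algebra.FiniteType K A] [Field L] [Algebra K L] [Algebra A L]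
    [IsScalarTower K A L] [IsFractionRing A L] (E : Derivation K L L) :
    ∃ b : A, b ≠ 0 ∧ ∀ a : A, IsLocalization.IsInteger A (b • E (algebraMap A L a)) := by
  classical
  obtain ⟨G, hG⟩ := Algebra.FiniteType.out (R := K) (A := A)
  obtain ⟨b, hb⟩ := IsLocalization.exist_integer_multiples_of_finset (nonZeroDivisors A)
    (G.image fun a ↦ E (algebraMap A L a))
  refine ⟨b, nonZeroDivisors.ne_zero b.2, fun a ↦ ?_⟩
  have ha : a ∈ Algebra.adjoin K (G : Set A) := hG ▸ trivial
  induction ha using Algebra.adjoin_induction with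
  | mem a ha => exact hb _ (Finset.mem_image_of_mem _ ha)
  | algebraMap r =>
    rw [← IsScalarTower.algebraMap_apply K A L, E.map_algebraMap, smul_zero]
    exact IsLocalization.isInteger_zero
  | add p q _ _ hp hq =>
    rw [map_add, map_add, smul_add]
    exact IsLocalization.isInteger_add hp hq
  | mul p q _ _ hp hq =>
    rw [map_mul, E.leibniz, algebraMap_smul, algebraMap_smul, smul_add, smul_comm _ p,
      smul_comm _ q]
    exact IsLocalization.isInteger_add (IsLocalization.isInteger_smul hq)
      (IsLocalization.isInteger_smul hp)

/-- A derivation of the fraction field commuting with (the extension of) a locally nilpotent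
derivation `D` becomes, after multiplication by a nonzero element of `ker D`, the extension of a
derivation of `A` commuting with `D`. -/
theorem Derivation.exists_smul_extends_of_commute {K A L : Type*} [Field K] [CommRing A]
    [IsDomain A] [Algebra K A] [Algebra.FiniteType K A] [Field L] [Algebra K L] [Algebra A L]
    [IsScalarTower K A L] [IsFractionRing A L] (D : Derivation K A A) (δ E : Derivation K L L)
    (hδ : ∀ a, δ (algebraMap A L a) = algebraMap A L (D a))
    (hln : ∀ a : A, ∃ k : ℕ, (⇑D)^[k] a = 0) (hE : ∀ r, E (δ r) = δ (E r)) :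
    ∃ b : A, b ≠ 0 ∧ ∃ T : Derivation K A A, ⁅T, D⁆ = 0 ∧
      ∀ a, algebraMap A L b * E (algebraMap A L a) = algebraMap A L (T a) := by
  have hinj := IsFractionRing.injective A L
  obtain ⟨b, hb0, hb⟩ := E.exists_ne_zero_forall_isInteger (A := A)
  obtain ⟨m, hm0, hm⟩ := exists_iterate_ne_zero_of_locally_nilpotent hb0 (hln b)
  have hint (j : ℕ) : ∀ a : A,
      IsLocalization.IsInteger A ((⇑D)^[j] b • E (algebraMap A L a)) := by
    induction j with
    | zero => exact hb
    | succ j ih =>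
      intro a
      obtain ⟨u, hu⟩ := ih a
      obtain ⟨v, hv⟩ := ih (D a)
      refine ⟨D u - v, ?_⟩
      rw [map_sub, ← hδ, hu, hv, ← hδ a, hE, Function.iterate_succ_apply', Algebra.smul_def,
        Algebra.smul_def, Algebra.smul_def, δ.leibniz, hδ]
      simp only [smul_eq_mul]
      ring
  choose T hT using hint m
  set c := (⇑D)^[m] b
  have hT (a : A) : algebraMap A L (T a) = algebraMap A L c * E (algebraMap A L a) := by
    rw [hT, Algebra.smul_def]
  refine ⟨c, hm0, Derivation.mk'
    { toFun := T
      map_add' := fun p q ↦ hinj ?_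
      map_smul' := fun k p ↦ hinj ?_ } fun p q ↦ hinj ?_, ?_, fun a ↦ (hT a).symm⟩
  · simp only [map_add, hT, mul_add]
  · simp only [hT, Algebra.smul_def, map_mul,
      ← IsScalarTower.algebraMap_apply K A L, E.leibniz, E.map_algebraMap,
      Algebra.algebraMap_self, RingHom.id_apply]
    ring
  · change algebraMap A L (T (p * q)) = algebraMap A L (p • T q + q • T p)
    simp only [smul_eq_mul, map_add, map_mul, hT, E.leibniz]
    ring
  · ext a
    rw [Derivation.commutator_apply]
    change T (D a) - D (T a) = 0
    refine hinj ?_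
    rw [map_sub, hT, ← hδ, ← hδ, hT, hE, δ.leibniz, hδ c, hm]
    simp

/-- The fraction field of a domain with a nonzero locally nilpotent derivation `D` has a
transcendence basis consisting of constants and of one element on which `D` takes the
value `1`. -/
theorem Derivation.exists_isTranscendenceBasis_of_locally_nilpotent {K A L : Type*} [Field K]
    [CharZero K] [CommRing A] [IsDomain A] [Algebra K A] [Field L] [Algebra K L] [Algebra A L]
    [IsScalarTower K A L] [IsFractionRing A L] (D : Derivation K A A) (δ : Derivation K L L)
    (hδ : ∀ a, δ (algebraMap A L a) = algebraMap A L (D a)) (hD0 : D ≠ 0)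
    (hln : ∀ a : A, ∃ k : ℕ, (⇑D)^[k] a = 0) :
    ∃ (s : Set δ.constants) (x : L), δ x = 1 ∧ IsTranscendenceBasis K
      (Sum.elim (fun _ : Unit ↦ x) (algebraMap δ.constants L ∘ ((↑) : s → δ.constants))) := by
  have hinj := IsFractionRing.injective A L
  have : CharZero L := charZero_of_injective_algebraMap (algebraMap K L).injective
  obtain ⟨a, ha⟩ : ∃ a, D a ≠ 0 := by
    by_contra! h
    exact hD0 (Derivation.ext h)
  obtain ⟨m, hm0, hm⟩ := exists_iterate_ne_zero_of_locally_nilpotent ha (hln (D a))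
  rw [← Function.iterate_succ_apply, Function.iterate_succ_apply'] at hm0 hm
  generalize (⇑D)^[m] a = s at hm0 hm
  have hc0 : algebraMap A L (D s) ≠ 0 := by rwa [Ne, map_eq_zero_iff _ hinj]
  have hx : δ (algebraMap A L s / algebraMap A L (D s)) = 1 := by
    rw [δ.leibniz_div_const _ _ (by rw [hδ, hm, map_zero]), hδ, smul_eq_mul,
      inv_mul_cancel₀ hc0]
  have hiter (k : ℕ) (a : A) : (⇑δ)^[k] (algebraMap A L a) = algebraMap A L ((⇑D)^[k] a) :=
    (Function.Semiconj.iterate_right (f := algebraMap A L) (fun a ↦ (hδ a).symm) k a).symm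
  obtain ⟨t, ht⟩ := exists_isTranscendenceBasis K δ.constants
  refine ⟨t, _, hx, ht.sumElim_comp (δ.isTranscendenceBasis_of_apply_eq_one (A := A) hx fun a ↦ ?_)⟩
  obtain ⟨k, hk⟩ := hln a
  exact ⟨k, by rw [hiter, hk, map_zero]⟩

/-- In characteristic zero, evaluation on a transcendence basis identifies the space of
derivations of a field with the space of functions on the basis. -/
noncomputable def IsTranscendenceBasis.derivationEquiv {ι K L : Type*} [Field K] [CharZero K]
    [Field L] [Algebra K L] {y : ι → L} (hy : IsTranscendenceBasis K y) :
    Derivation K L L ≃ₗ[L] (ι → L) :=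
  LinearEquiv.ofBijective
    { toFun := fun d i ↦ d (y i)
      map_add' := fun _ _ ↦ rfl
      map_smul' := fun _ _ ↦ rfl }
    ((Function.bijective_iff_existsUnique _).2 fun v ↦ by
      simpa [funext_iff] using hy.existsUnique_derivation v)

theorem IsTranscendenceBasis.derivationEquiv_apply {ι K L : Type*} [Field K] [CharZero K]
    [Field L] [Algebra K L] {y : ι → L} (hy : IsTranscendenceBasis K y)
    (d : Derivation K L L) (i : ι) : hy.derivationEquiv d i = d (y i) := rfl

/-- If a derivation of `L` takes values in `K` on a transcendence basis, then it commutes with the partial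
derivatives with respect to that basis. -/
theorem IsTranscendenceBasis.derivationEquiv_symm_single_commute {ι K L : Type*} [DecidableEq ι]
    [Field K] [CharZero K] [Field L] [Algebra K L] {y : ι → L} (hy : IsTranscendenceBasis K y)
    (δ : Derivation K L L) (hδ : ∀ i, δ (y i) ∈ (algebraMap K L).range) (i : ι) (r : L) :
    hy.derivationEquiv.symm (Pi.single i 1) (δ r) =
      δ (hy.derivationEquiv.symm (Pi.single i 1) r) := by
  set E := hy.derivationEquiv.symm (Pi.single i 1)
  have hE (j : ι) : E (y j) = (Pi.single i 1 : ι → L) j := by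
    rw [← hy.derivationEquiv_apply, LinearEquiv.apply_symm_apply]
  have : ⁅E, δ⁆ = 0 := hy.derivationEquiv.injective <| by
    ext j
    obtain ⟨k, hk⟩ := hδ j
    rw [hy.derivationEquiv_apply, Derivation.commutator_apply, ← hk, E.map_algebraMap, hE]
    rcases eq_or_ne j i with rfl | h <;> simp [*]
  rw [← sub_eq_zero, ← Derivation.commutator_apply, this, Derivation.zero_apply]

/-- Let `A` be a finitely generated domain over `K` of transcendence degree `n` and `D ≠ 0`
a locally nilpotent derivation of `A`. Extending derivations of `A` to `R = Frac(A)`, the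
`R`-span in `Der_K(R)` of the (extensions of the) centralizer of `D` has dimension exactly
`n` over `R`: the rank of `C_{Der_K A}(D)` over `A` equals `tr.deg_K(A)`. -/
theorem rank_of_centralizer_of_locally_nilpotent
    (K A : Type*) [Field K] [CharZero K] [CommRing A] [IsDomain A]
    [Algebra K A] [Algebra.FiniteType K A]
    (n : ℕ) (t : Fin n → A) (ht : IsTranscendenceBasis K t)
    (D : Derivation K A A) (hD0 : D ≠ 0)
    (hln : ∀ a : A, ∃ k : ℕ, (⇑D)^[k] a = 0) :
    Module.finrank (FractionRing A)
      ↥(Submodule.span (FractionRing A)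
        {T' : Derivation K (FractionRing A) (FractionRing A) |
          ∃ T : Derivation K A A, ⁅T, D⁆ = 0 ∧
            ∀ a : A, T' (algebraMap A (FractionRing A) a)
              = algebraMap A (FractionRing A) (T a)}) = n := by
  classical
  set R := FractionRing A
  have : Algebra.FormallyEtale A R := .of_isLocalization (nonZeroDivisors A)
  obtain ⟨δ, hδ, -⟩ := Derivation.existsUnique_extension_of_formallyEtale (T := R)
    ((Algebra.linearMap A R).compDer D)
  replace hδ (a : A) : δ (algebraMap A R a) = algebraMap A R (D a) := hδ a
  obtain ⟨s, x, hx, hy⟩ := D.exists_isTranscendenceBasis_of_locally_nilpotent δ hδ hD0 hln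
  have : Algebra.IsAlgebraic A R := IsLocalization.isAlgebraic R (nonZeroDivisors A)
  have ht' : IsTranscendenceBasis K (algebraMap A R ∘ t) := ht.algebraMap_comp
  have hcard := hy.lift_cardinalMk_eq ht'
  rw [Cardinal.lift_mk_eq'] at hcard
  obtain ⟨e⟩ := hcard
  have := Fintype.ofEquiv _ e.symm
  have hn : Fintype.card (Unit ⊕ s) = n := by simpa using Fintype.card_congr e
  let B := (Pi.basisFun R (Unit ⊕ s)).map hy.derivationEquiv.symm
  suffices h : Set.range B ⊆ Submodule.span R {T' : Derivation K R R | ∃ T : Derivation K A A,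
      ⁅T, D⁆ = 0 ∧ ∀ a : A, T' (algebraMap A R a) = algebraMap A R (T a)} by
    rw [eq_top_iff.2 (B.span_eq.symm.le.trans (Submodule.span_le.2 h)), finrank_top,
      Module.finrank_eq_card_basis B, hn]
  rintro _ ⟨i, rfl⟩
  have hcomm := hy.derivationEquiv_symm_single_commute δ (fun
    | .inl _ => ⟨1, by simp [hx]⟩
    | .inr j => ⟨0, by simpa using (Derivation.mem_constants.1 j.1.2).symm⟩) i
  have hB : B i = hy.derivationEquiv.symm (Pi.single i 1) := by simp [B]
  rw [← hB] at hcomm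
  obtain ⟨b, hb0, T, hT, hTb⟩ := D.exists_smul_extends_of_commute δ (B i) hδ hln hcomm
  have hb : algebraMap A R b ≠ 0 := by
    rwa [Ne, map_eq_zero_iff _ (IsFractionRing.injective A R)]
  rw [← inv_smul_smul₀ hb (B i)]
  exact Submodule.smul_mem _ _ (Submodule.subset_span ⟨T, hT, hTb⟩)
end

section
/- Let K be a field of characteristic zero and A = K[x_1, x_2, x_3]. Let D_3 be the basic Weitzenböck derivation of A, D_3 = x_1 ∂_2 + x_2 ∂_3 (so D_3(x_1)=0, D_3(x_2)=x_1, D_3(x_3)=x_2). Then the kernel Ker D_3 is the K-subalgebra of A generated by the two polynomials x_1 and x_1 x_3 − (1/2) x_2^2. -/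
open MvPolynomial

/-- A `K`-derivation `D` of `K[x_1,…]` and a `K`-derivation `d` of `S` are intertwined by an
algebra map as soon as they are on the variables. -/
theorem MvPolynomial.derivation_comp_aeval {σ K S : Type*} [CommRing K] [CommRing S] [Algebra K S]
    (D : Derivation K (MvPolynomial σ K) (MvPolynomial σ K)) (d : Derivation K S S)
    (φ : MvPolynomial σ K →ₐ[K] S) (h : ∀ i, d (φ (X i)) = φ (D (X i)))
    (f : MvPolynomial σ K) : d (φ f) = φ (D f) := by
  induction f using MvPolynomial.induction_on with
  | C a => simp [← MvPolynomial.algebraMap_eq]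
  | add p q hp hq => simp [hp, hq]
  | mul_X p i hp => simp [hp, h]

section Weitzenbock

variable {K : Type*} [Field K]

/-- The subalgebra of `K[x_1,x_2,x_3]` generated by `x_1` and `x_1x_3 − (1/2)x_2²`. -/
noncomputable def weitzenbockSubalgebra (K : Type*) [Field K] : Subalgebra K (MvPolynomial (Fin 3) K) :=
  Algebra.adjoin K {X 0, X 0 * X 2 - C (1/2 : K) * (X 1) ^ 2}

theorem X_zero_mem_weitzenbockSubalgebra : X 0 ∈ weitzenbockSubalgebra K :=
  Algebra.subset_adjoin (by simp)

theorem quadric_mem_weitzenbockSubalgebra :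
    X 0 * X 2 - C (1/2 : K) * (X 1) ^ 2 ∈ weitzenbockSubalgebra K :=
  Algebra.subset_adjoin (by simp)

theorem exists_eq_aeval_add_X_zero_mul {f : MvPolynomial (Fin 3) K}
    (hf : f ∈ weitzenbockSubalgebra K) :
    ∃ p : Polynomial K, ∃ b ∈ weitzenbockSubalgebra K,
      f = Polynomial.aeval (X 0 * X 2 - C (1/2 : K) * (X 1) ^ 2) p + X 0 * b := by
  have hq (p : Polynomial K) : Polynomial.aeval (X 0 * X 2 - C (1/2 : K) * (X 1) ^ 2) p ∈
      weitzenbockSubalgebra K :=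
    Algebra.adjoin_le (Set.singleton_subset_iff.mpr quadric_mem_weitzenbockSubalgebra)
      (Polynomial.aeval_mem_adjoin_singleton K _)
  induction hf using Algebra.adjoin_induction with
  | mem x hx =>
    rcases hx with rfl | rfl
    · exact ⟨0, 1, one_mem _, by simp⟩
    · exact ⟨Polynomial.X, 0, zero_mem _, by simp⟩
  | algebraMap r => exact ⟨Polynomial.C r, 0, zero_mem _, by simp⟩
  | add x y _ _ hx hy =>
    obtain ⟨p, b, hb, rfl⟩ := hx
    obtain ⟨p', b', hb', rfl⟩ := hy
    exact ⟨p + p', b + b', add_mem hb hb', by rw [map_add]; ring⟩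
  | mul x y _ hy' hx hy =>
    obtain ⟨p, b, hb, rfl⟩ := hx
    obtain ⟨p', b', hb', rfl⟩ := hy
    exact ⟨p * p', _, add_mem (mul_mem (hq p) hb') (mul_mem hb hy'), by rw [map_mul]; ring⟩

theorem mem_weitzenbockSubalgebra_of_X_zero_mul_mem [CharZero K] {f : MvPolynomial (Fin 3) K}
    (hf : X 0 * f ∈ weitzenbockSubalgebra K) : f ∈ weitzenbockSubalgebra K := by
  obtain ⟨p, b, hb, h⟩ := exists_eq_aeval_add_X_zero_mul hf
  have hp : p = 0 := by
    have h0 := congrArg (aeval (![0, Polynomial.X, 0] : Fin 3 → Polynomial K)) h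
    rw [map_add, ← Polynomial.aeval_algHom_apply] at h0
    simp only [map_mul, map_sub, map_pow, aeval_X, Matrix.cons_val, zero_mul, zero_sub, add_zero,
      algHom_C, Polynomial.algebraMap_eq, ← Polynomial.comp_eq_aeval] at h0
    rcases Polynomial.comp_eq_zero_iff.mp h0.symm with h1 | ⟨-, h1⟩
    · exact h1
    · simpa using congrArg (Polynomial.coeff · 2) h1
  rw [hp, map_zero, zero_add] at h
  rwa [mul_left_cancel₀ (X_ne_zero 0) h]

theorem mem_weitzenbockSubalgebra_of_X_zero_pow_mul_mem [CharZero K] {f : MvPolynomial (Fin 3) K}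
    (m : ℕ) (hf : X 0 ^ m * f ∈ weitzenbockSubalgebra K) : f ∈ weitzenbockSubalgebra K := by
  induction m with
  | zero => simpa using hf
  | succ m ih =>
    exact ih (mem_weitzenbockSubalgebra_of_X_zero_mul_mem (by rwa [← mul_assoc, ← pow_succ']))

/-- Denominators of `f(x_1, 0, q/x_1)`, where `q = x_1x_3 − (1/2)x_2²`, are powers of `x_1`. -/
theorem exists_X_zero_pow_mul_aeval_eq {L : Type*} [Field L] [Algebra K L]
    (ι : MvPolynomial (Fin 3) K →ₐ[K] L) (h0 : ι (X 0) ≠ 0) (f : MvPolynomial (Fin 3) K) :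
    ∃ m : ℕ, ∃ b ∈ weitzenbockSubalgebra K,
      ι (X 0) ^ m * aeval ![ι (X 0), 0, ι (X 0 * X 2 - C (1/2 : K) * (X 1) ^ 2) / ι (X 0)] f =
        ι b := by
  induction f using MvPolynomial.induction_on with
  | C a => exact ⟨0, C a, Subalgebra.algebraMap_mem _ a, by simp⟩
  | add p q hp hq =>
    obtain ⟨m, b, hb, h⟩ := hp
    obtain ⟨m', b', hb', h'⟩ := hq
    refine ⟨m + m', X 0 ^ m' * b + X 0 ^ m * b',
      add_mem (mul_mem (pow_mem X_zero_mem_weitzenbockSubalgebra _) hb)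
        (mul_mem (pow_mem X_zero_mem_weitzenbockSubalgebra _) hb'), ?_⟩
    rw [map_add, map_add, map_mul, map_mul, map_pow, map_pow, ← h, ← h']
    ring
  | mul_X p i hp =>
    obtain ⟨m, b, hb, h⟩ := hp
    fin_cases i
    · refine ⟨m, b * X 0, mul_mem hb X_zero_mem_weitzenbockSubalgebra, ?_⟩
      rw [map_mul, map_mul, ← h, ← mul_assoc]
      simp
    · exact ⟨0, 0, zero_mem _, by simp⟩
    · refine ⟨m + 1, b * _, mul_mem hb quadric_mem_weitzenbockSubalgebra, ?_⟩
      rw [map_mul, map_mul, ← h, aeval_X]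
      simp only [Fin.reduceFinMk, Matrix.cons_val]
      field_simp
      ring

/-- An element of the kernel is constant along the flow `exp (tD)`; evaluating at time
`t = -x_2/x_1` gives `f = f(x_1, 0, q/x_1)`, where `q = x_1x_3 − (1/2)x_2²`. -/
theorem eq_aeval_of_weitzenbock_eq_zero [CharZero K] {L : Type*} [Field L] [Algebra K L]
    (ι : MvPolynomial (Fin 3) K →ₐ[K] L) (h0 : ι (X 0) ≠ 0)
    (D : Derivation K (MvPolynomial (Fin 3) K) (MvPolynomial (Fin 3) K))
    (hD : D (X 0) = 0 ∧ D (X 1) = X 0 ∧ D (X 2) = X 1)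
    {f : MvPolynomial (Fin 3) K} (hf : D f = 0) :
    aeval ![ι (X 0), 0, ι (X 0 * X 2 - C (1/2 : K) * (X 1) ^ 2) / ι (X 0)] f = ι f := by
  have : CharZero L := charZero_of_injective_algebraMap (algebraMap K L).injective
  obtain ⟨hD0, hD1, hD2⟩ := hD
  have h2 : algebraMap K L 2 = 2 := map_ofNat _ 2
  set q := ι (X 0 * X 2 - C (1/2 : K) * (X 1) ^ 2) with hq
  let ψ : MvPolynomial (Fin 3) K →ₐ[K] Polynomial L :=
    aeval ![Polynomial.C (ι (X 0)), Polynomial.C (ι (X 0)) * Polynomial.X,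
      Polynomial.C (q / ι (X 0)) + Polynomial.C (ι (X 0) / 2) * Polynomial.X ^ 2]
  have hψ : Polynomial.derivative (ψ f) = 0 := by
    have := MvPolynomial.derivation_comp_aeval D
      ((Polynomial.derivative' (R := L)).restrictScalars K) ψ (fun i => by
        fin_cases i
        · simp [ψ, hD0]
        · simp [ψ, hD1]
        · simp only [Fin.reduceFinMk, hD2, ψ, aeval_X, Matrix.cons_val,
            Derivation.restrictScalars_apply, Polynomial.derivative'_apply]
          simp only [Polynomial.derivative_add, Polynomial.derivative_C,
            Polynomial.derivative_C_mul, Polynomial.derivative_X_pow, zero_add]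
          rw [← mul_assoc, ← Polynomial.C_mul]
          simp) f
    simpa [hf] using this
  obtain ⟨c, hc⟩ := Polynomial.natDegree_eq_zero.mp
    (Polynomial.derivative_eq_zero.mp hψ)
  have key (t : L) : aeval (fun i => Polynomial.eval t (ψ (X i))) f = c := by
    have h : aeval (fun i => Polynomial.eval t (ψ (X i))) =
        ((Polynomial.aeval (R := L) t).restrictScalars K).comp ψ := by
      ext i
      simp
    rw [h, AlgHom.comp_apply, ← hc]
    simp
  have e0 : (fun i => Polynomial.eval 0 (ψ (X i))) = ![ι (X 0), 0, q / ι (X 0)] := by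
    ext i; fin_cases i <;> simp [ψ]
  have e1 : (fun i => Polynomial.eval (ι (X 1) / ι (X 0)) (ψ (X i))) = fun i => ι (X i) := by
    ext i
    fin_cases i
    · simp [ψ]
    · simp [ψ]; field_simp
    · simp [ψ, hq, h2]; field_simp; ring
  rw [← e0, key, ← key (ι (X 1) / ι (X 0)), e1]
  exact (DFunLike.congr_fun (aeval_unique ι) f).symm

end Weitzenbock


/-- The kernel of the basic Weitzenböck derivation `D_3 = x_1∂_2 + x_2∂_3` of
`K[x_1,x_2,x_3]` is the `K`-subalgebra generated by `x_1` and `x_1x_3 − (1/2)x_2²`. -/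
theorem kernel_weitzenbock_three_variables
    (K : Type*) [Field K] [CharZero K]
    (D : Derivation K (MvPolynomial (Fin 3) K) (MvPolynomial (Fin 3) K))
    (hD : D (X 0) = 0 ∧ D (X 1) = X 0 ∧ D (X 2) = X 1) :
    ∀ f : MvPolynomial (Fin 3) K,
      D f = 0 ↔
        f ∈ Algebra.adjoin K
          ({X 0, X 0 * X 2 - C (1/2 : K) * (X 1) ^ 2} :
            Set (MvPolynomial (Fin 3) K)) := by
  intro f
  constructor
  · intro hf
    let ι := IsScalarTower.toAlgHom K (MvPolynomial (Fin 3) K)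
      (FractionRing (MvPolynomial (Fin 3) K))
    have hι : Function.Injective ι := IsFractionRing.injective _ _
    have h0 : ι (X 0) ≠ 0 := (map_ne_zero_iff ι hι).mpr (X_ne_zero 0)
    obtain ⟨m, b, hb, h⟩ := exists_X_zero_pow_mul_aeval_eq ι h0 f
    rw [eq_aeval_of_weitzenbock_eq_zero ι h0 D hD hf, ← map_pow, ← map_mul] at h
    exact mem_weitzenbockSubalgebra_of_X_zero_pow_mul_mem m (hι h ▸ hb)
  · obtain ⟨hD0, hD1, hD2⟩ := hD
    intro hf
    induction hf using Algebra.adjoin_induction with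
    | mem x hx =>
      rcases hx with rfl | rfl
      · exact hD0
      · have h2 : (C (1/2 : K) * 2 : MvPolynomial (Fin 3) K) = 1 := by
          rw [← map_ofNat C 2, ← C_mul]; simp
        simp only [map_sub, Derivation.leibniz, Derivation.leibniz_pow, derivation_C, hD0, hD1,
          hD2, smul_eq_mul, nsmul_eq_mul]
        push_cast
        linear_combination -(X 0 * X 1) * h2
    | algebraMap r => exact D.map_algebraMap r
    | add x y _ _ hx hy => rw [map_add, hx, hy, add_zero]
    | mul x y _ _ hx hy => rw [D.leibniz, hx, hy, smul_zero, smul_zero, add_zero]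
end

section
/- Let K be a field of characteristic zero, A = K[x_1, x_2, x_3], and D_3 = x_1 ∂_2 + x_2 ∂_3 the basic Weitzenböck derivation of A. Then the centralizer C_{W_3(K)}(D_3) = {T ∈ Der_K(A) : [T, D_3] = 0}, regarded as a module over Ker D_3, is generated by the four derivations ∂_3, x_1 ∂_2 + x_2 ∂_3, 2x_1 ∂_1 + 2x_2 ∂_2 + 2x_3 ∂_3, and 8x_1^2 ∂_1 + 8x_1 x_2 ∂_2 + 4x_2^2 ∂_3. -/
open MvPolynomial

namespace Weitzenbock

variable {K : Type*} [Field K]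
  {D : Derivation K (MvPolynomial (Fin 3) K) (MvPolynomial (Fin 3) K)}

/-- The algebra endomorphism of `K[x_1,x_2,x_3]` that changes the sign of `x_2`. -/
noncomputable def reflection (K : Type*) [Field K] :
    MvPolynomial (Fin 3) K →ₐ[K] MvPolynomial (Fin 3) K :=
  aeval ![X 0, -X 1, X 2]

lemma reflection_X_zero : reflection K (X 0) = X 0 := by simp [reflection]

lemma reflection_X_one : reflection K (X 1) = -X 1 := by simp [reflection]

lemma derivation_reflection (hD : D (X 0) = 0 ∧ D (X 1) = X 0 ∧ D (X 2) = X 1)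
    (a : MvPolynomial (Fin 3) K) : D (reflection K a) = -reflection K (D a) := by
  obtain ⟨h0, h1, h2⟩ := hD
  induction a using MvPolynomial.induction_on with
  | C r => simp [reflection]
  | add p q hp hq => simp only [map_add, hp, hq]; ring
  | mul_X p i hp =>
    simp only [map_mul, Derivation.leibniz, smul_eq_mul, map_add, hp]
    fin_cases i <;> simp [reflection, h0, h1, h2] <;> ring

lemma X_one_dvd_reflection_sub (a : MvPolynomial (Fin 3) K) :
    X 1 ∣ reflection K a - a := by
  induction a using MvPolynomial.induction_on with
  | C r => simp [reflection]
  | add p q hp hq =>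
    have : reflection K (p + q) - (p + q) = (reflection K p - p) + (reflection K q - q) := by
      rw [map_add]; ring
    rw [this]
    exact dvd_add hp hq
  | mul_X p i hp =>
    have hX : X 1 ∣ reflection K (X i) - X i := by
      fin_cases i
      · simp [reflection]
      · exact ⟨-2, by simp [reflection]; ring⟩
      · simp [reflection]
    have : reflection K (p * X i) - p * X i =
        (reflection K p - p) * reflection K (X i) + p * (reflection K (X i) - X i) := by
      rw [map_mul]; ring
    rw [this]
    exact dvd_add (hp.mul_right _) (hX.mul_left _)

lemma X_zero_not_dvd_X_one : ¬ (X 0 : MvPolynomial (Fin 3) K) ∣ X 1 := by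
  simp [X_dvd_X]

lemma X_one_not_dvd_X_zero : ¬ (X 1 : MvPolynomial (Fin 3) K) ∣ X 0 := by
  simp [X_dvd_X]

variable [CharZero K]

lemma eq_zero_of_X_one_dvd (hD : D (X 0) = 0 ∧ D (X 1) = X 0 ∧ D (X 2) = X 1)
    {a : MvPolynomial (Fin 3) K} (ha : D a = 0) (hdvd : X 1 ∣ a) : a = 0 := by
  by_contra hne
  have hp : Prime (X 1 : MvPolynomial (Fin 3) K) := X_prime
  obtain ⟨b, hb, hnd⟩ :=
    (FiniteMultiplicity.of_prime_left hp hne).exists_eq_pow_mul_and_not_dvd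
  generalize multiplicity (X 1) a = n at hb
  cases n with
  | zero => exact hnd (by simpa [hb] using hdvd)
  | succ n =>
    rw [hb] at ha
    simp only [Derivation.leibniz, Derivation.leibniz_pow, hD.2.1, smul_eq_mul, nsmul_eq_mul,
      Nat.add_sub_cancel] at ha
    have h : (X 1 : MvPolynomial (Fin 3) K) ^ n *
        (X 1 * D b + ((n + 1 : ℕ) : MvPolynomial (Fin 3) K) * (X 0 * b)) = 0 := by
      linear_combination ha
    have h' := (mul_eq_zero.mp h).resolve_left (pow_ne_zero _ hp.ne_zero)
    have hd : X 1 ∣ X 0 * b := by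
      have hu : IsUnit ((n + 1 : ℕ) : MvPolynomial (Fin 3) K) := by
        rw [← map_natCast (C (σ := Fin 3) (R := K))]
        exact (IsUnit.mk0 _ (Nat.cast_ne_zero.mpr n.succ_ne_zero)).map C
      refine (hu.dvd_mul_left).mp ⟨-D b, ?_⟩
      linear_combination h'
    exact (hp.dvd_or_dvd hd).elim X_one_not_dvd_X_zero hnd

lemma reflection_eq_self (hD : D (X 0) = 0 ∧ D (X 1) = X 0 ∧ D (X 2) = X 1)
    {a : MvPolynomial (Fin 3) K} (ha : D a = 0) : reflection K a = a :=
  sub_eq_zero.mp <| eq_zero_of_X_one_dvd hD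
    (by rw [map_sub, derivation_reflection hD, ha, map_zero, neg_zero, sub_zero])
    (X_one_dvd_reflection_sub a)

/-- The submodule `Ker D + Ker D • x_2 + Ker D • x_3` is closed under division by `x_1`. -/
lemma exists_of_X_zero_mul (hD : D (X 0) = 0 ∧ D (X 1) = X 0 ∧ D (X 2) = X 1)
    {a b c g : MvPolynomial (Fin 3) K} (ha : D a = 0) (hb : D b = 0) (hc : D c = 0)
    (h : X 0 * g = a + b * X 1 + c * X 2) :
    ∃ a' b' c', D a' = 0 ∧ D b' = 0 ∧ D c' = 0 ∧ g = a' + b' * X 1 + c' * X 2 := by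
  have hp : Prime (X 0 : MvPolynomial (Fin 3) K) := X_prime
  have hker : ∀ u, D (X 0 * u) = 0 → D u = 0 := fun u hu => by
    rw [Derivation.leibniz, hD.1, smul_zero, add_zero, smul_eq_mul] at hu
    exact (mul_eq_zero.mp hu).resolve_left hp.ne_zero
  have hdc : X 0 ∣ c := by
    have h' := congrArg D h
    simp only [map_add, Derivation.leibniz, ha, hb, hc, hD.1, hD.2.1, hD.2.2, smul_eq_mul,
      mul_zero, add_zero, zero_add] at h'
    have hd : X 0 ∣ c * X 1 := ⟨D g - b, by linear_combination -h'⟩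
    exact (hp.dvd_or_dvd hd).resolve_right X_zero_not_dvd_X_one
  obtain ⟨c', rfl⟩ := hdc
  have hab : X 0 * (g - c' * X 2) = a + b * X 1 := by linear_combination h
  have hσ := congrArg (reflection K) hab
  rw [map_mul, map_add, map_mul, reflection_eq_self hD ha, reflection_eq_self hD hb,
    reflection_X_zero, reflection_X_one] at hσ
  have hda : X 0 ∣ a := by
    have hu : IsUnit (2 : MvPolynomial (Fin 3) K) := by
      rw [← map_ofNat (C (σ := Fin 3) (R := K)) 2]
      exact (IsUnit.mk0 _ two_ne_zero).map C
    refine hu.dvd_mul_left.mp ⟨(g - c' * X 2) + reflection K (g - c' * X 2), ?_⟩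
    linear_combination -hab - hσ
  obtain ⟨a', rfl⟩ := hda
  have hdb : X 0 ∣ b := by
    have hd : X 0 ∣ b * X 1 := ⟨g - c' * X 2 - a', by linear_combination -hab⟩
    exact (hp.dvd_or_dvd hd).resolve_right X_zero_not_dvd_X_one
  obtain ⟨b', rfl⟩ := hdb
  refine ⟨a', b', c', hker _ ha, hker _ hb, hker _ hc, mul_left_cancel₀ hp.ne_zero ?_⟩
  linear_combination h

/-- The kernel of `D ^ 3` is generated by `1`, `x_2` and `x_3` as a module over `Ker D`. -/
lemma exists_of_derivation_cube_eq_zero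
    (hD : D (X 0) = 0 ∧ D (X 1) = X 0 ∧ D (X 2) = X 1)
    {f : MvPolynomial (Fin 3) K} (hf : D (D (D f)) = 0) :
    ∃ a b c, D a = 0 ∧ D b = 0 ∧ D c = 0 ∧ f = a + b * X 1 + c * X 2 := by
  have hDh : D (X 0 * D f - D (D f) * X 1) = 0 := by
    simp only [map_sub, Derivation.leibniz, hf, hD.1, hD.2.1, smul_eq_mul]
    ring
  obtain ⟨a, b, c, ha, hb, hc, h⟩ := exists_of_X_zero_mul hD (g := X 0 * f)
    (a := X 0 * (X 0 * f - D (D f) * X 2) - (X 0 * D f - D (D f) * X 1) * X 1)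
    (b := X 0 * D f - D (D f) * X 1) (c := X 0 * D (D f))
    (by
      rw [map_sub, Derivation.leibniz _ (X 0 * D f - _) (X 1), hDh]
      simp only [map_sub, Derivation.leibniz, hf, hD.1, hD.2.1, hD.2.2, smul_eq_mul]
      ring)
    hDh
    (by simp [Derivation.leibniz, hf, hD.1])
    (by ring)
  exact exists_of_X_zero_mul hD ha hb hc h

end Weitzenbock

/-- The centralizer of the basic Weitzenböck derivation `D_3 = x_1∂_2 + x_2∂_3` of
`K[x_1,x_2,x_3]` is generated, as a module over `Ker D_3`, by the four derivations
`∂_3`, `x_1∂_2 + x_2∂_3`, `2x_1∂_1 + 2x_2∂_2 + 2x_3∂_3`, and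
`8x_1²∂_1 + 8x_1x_2∂_2 + 4x_2²∂_3`. -/
theorem centralizer_weitzenbock_three_variables
    (K : Type*) [Field K] [CharZero K]
    (D : Derivation K (MvPolynomial (Fin 3) K) (MvPolynomial (Fin 3) K))
    (hD : D (X 0) = 0 ∧ D (X 1) = X 0 ∧ D (X 2) = X 1) :
    ∀ T : Derivation K (MvPolynomial (Fin 3) K) (MvPolynomial (Fin 3) K),
      (∀ a, T (D a) = D (T a)) ↔
        ∃ c₁ c₂ c₃ c₄ : MvPolynomial (Fin 3) K,
          D c₁ = 0 ∧ D c₂ = 0 ∧ D c₃ = 0 ∧ D c₄ = 0 ∧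
          T = c₁ • MvPolynomial.mkDerivation K ![0, 0, 1]
            + c₂ • MvPolynomial.mkDerivation K ![0, X 0, X 1]
            + c₃ • MvPolynomial.mkDerivation K
                ![C 2 * X 0, C 2 * X 1, C 2 * X 2]
            + c₄ • MvPolynomial.mkDerivation K
                ![C 8 * (X 0) ^ 2, C 8 * X 0 * X 1, C 4 * (X 1) ^ 2] := by
  have hD' := hD
  obtain ⟨h0, h1, h2⟩ := hD'
  have two_eq : (C 2 : MvPolynomial (Fin 3) K) = 2 := map_ofNat C 2
  have D_C : ∀ r : K, D (C r) = 0 := fun r => by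
    rw [← algebraMap_eq]; exact D.map_algebraMap r
  intro T
  constructor
  · intro hT
    have hT1 : T (X 1) = D (T (X 2)) := by rw [← hT, h2]
    have hT0 : T (X 0) = D (T (X 1)) := by rw [← hT, h1]
    obtain ⟨a, b, c, ha, hb, hc, h⟩ :=
      Weitzenbock.exists_of_derivation_cube_eq_zero hD (f := T (X 2))
        (by rw [← hT1, ← hT0, ← hT, h0, map_zero])
    have hT1' : T (X 1) = b * X 0 + c * X 1 := by
      rw [hT1, h]
      simp only [map_add, Derivation.leibniz, ha, hb, hc, h1, h2, smul_eq_mul]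
      ring
    have hT0' : T (X 0) = c * X 0 := by
      rw [hT0, hT1']
      simp only [map_add, Derivation.leibniz, hb, hc, h0, h1, smul_eq_mul]
      ring
    have hhalf : (C 2⁻¹ : MvPolynomial (Fin 3) K) * C 2 = 1 := by
      rw [← C_mul, inv_mul_cancel₀ two_ne_zero, C_1]
    refine ⟨a, b, C 2⁻¹ * c, 0, ha, hb, ?_, map_zero D, ?_⟩
    · simp [Derivation.leibniz, hc, D_C]
    · refine MvPolynomial.derivation_ext fun i => ?_
      fin_cases i
      · simp [mkDerivation_X, hT0']
        linear_combination (-c * X 0) * hhalf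
      · simp [mkDerivation_X, hT1']
        linear_combination (-c * X 1) * hhalf
      · simp [mkDerivation_X, h]
        linear_combination (-c * X 2) * hhalf
  · rintro ⟨c₁, c₂, c₃, c₄, hc₁, hc₂, hc₃, hc₄, hT⟩ a
    have hcomm : ⁅T, D⁆ = 0 := by
      refine MvPolynomial.derivation_ext fun i => ?_
      have e8 : (C 8 : MvPolynomial (Fin 3) K) = C 4 * 2 := by
        rw [← two_eq, ← C_mul]; norm_num
      have D_two : D 2 = 0 := by rw [← two_eq, D_C]
      rw [Derivation.commutator_apply, hT]
      fin_cases i <;>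
        simp [mkDerivation_X, Derivation.leibniz, Derivation.leibniz_pow, D_C, h0, h1, h2,
          hc₁, hc₂, hc₃, hc₄, e8, D_two] <;>
        ring
    have := DFunLike.congr_fun hcomm a
    rwa [Derivation.commutator_apply, Derivation.zero_apply, sub_eq_zero] at this
end
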